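/- Let m ≥ 0 be an integer and let I ⊆ ℝ be an interval. If n = 2m+1 then the Hausdorff dimension of S_n(I, 2/n) is at most (m+2)/(2m+3); if n = 2m+2 then the Hausdorff dimension of S_n(I, 2/n) is at most (m+3)/(2m+4). -/

import Mathlib

open MeasureTheory
open scoped ENNReal

/-- Distance from a real number to the nearest integer. -/
noncomputable def distNearestInt (y : ℝ) : ℝ := |y - round y|

/-- The `n`-th simultaneous Diophantine exponent `λ_n(x) ∈ [0,∞]`: the supremum of all
`λ > 0` such that `max_{1 ≤ i ≤ n} ‖q x^i‖ ≤ q^{-λ}` holds for infinitely many positive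
integers `q`. -/
noncomputable def simExponent (n : ℕ) (x : ℝ) : ℝ≥0∞ :=
  sSup (ENNReal.ofReal '' {l : ℝ | 0 < l ∧
    {q : ℕ | 0 < q ∧
      ∀ i ∈ Finset.Icc 1 n, distNearestInt ((q : ℝ) * x ^ i) ≤ (q : ℝ) ^ (-l)}.Infinite})

/-- `S_n(I, λ) = {x ∈ I : λ_n(x) > λ}`. -/
noncomputable def SimSet (n : ℕ) (I : Set ℝ) (lam : ℝ) : Set ℝ :=
  {x ∈ I | ENNReal.ofReal lam < simExponent n x}

namespace SimDioph
open Polynomial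

noncomputable section

/-- linear functional sending `X^i` to `p i` -/
def ell {K : Type*} [CommRing K] (p : ℕ → K) : K[X] →ₗ[K] K :=
  Polynomial.lsum fun i => p i • (LinearMap.id : K →ₗ[K] K)

variable {K : Type*} [CommRing K]

lemma ell_monomial (p : ℕ → K) (i : ℕ) (a : K) : ell p (monomial i a) = p i * a := by
  simp [ell, Polynomial.lsum_apply, Polynomial.sum_monomial_index]

lemma ell_X_pow (p : ℕ → K) (i : ℕ) : ell p (X ^ i) = p i := by
  rw [← monomial_one_right_eq_X_pow, ell_monomial, mul_one]

lemma ell_sum_range (p : ℕ → K) (R : K[X]) (N : ℕ) (h : R.natDegree < N) :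
    ell p R = ∑ i ∈ Finset.range N, R.coeff i * p i := by
  conv_lhs => rw [R.as_sum_range' N h]
  rw [map_sum]
  exact Finset.sum_congr rfl fun i _ => by rw [ell_monomial, mul_comm]

lemma ell_X_pow_mul (p : ℕ → K) (R : K[X]) (N j : ℕ) (h : R.natDegree < N) :
    ell p (X ^ j * R) = ∑ i ∈ Finset.range N, R.coeff i * p (i + j) := by
  conv_lhs => rw [R.as_sum_range' N h]
  rw [Finset.mul_sum, map_sum]
  refine Finset.sum_congr rfl fun i _ => ?_
  rw [X_pow_mul_monomial, ell_monomial, mul_comm]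

/-- shifted sequence -/
def cmp (p : ℕ → K) (G : K[X]) (j : ℕ) : K := ell p (X ^ j * G)

lemma ell_cmp (p : ℕ → K) (G R : K[X]) : ell (cmp p G) R = ell p (R * G) := by
  rw [ell_sum_range _ R (R.natDegree + 1) (Nat.lt_succ_self _)]
  conv_rhs => rw [R.as_sum_range]
  rw [Finset.sum_mul, map_sum]
  refine Finset.sum_congr rfl fun i _ => ?_
  rw [cmp, ← C_mul_X_pow_eq_monomial, mul_assoc, ← smul_eq_C_mul, map_smul, smul_eq_mul]

/-- `P` annihilates the window `p_0, …, p_N` -/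
def Kill (p : ℕ → K) (N : ℕ) (P : K[X]) : Prop :=
  ∀ j, j + P.natDegree ≤ N → ell p (X ^ j * P) = 0

lemma Kill.mul {p : ℕ → K} {N : ℕ} {P : K[X]} (h : Kill p N P) (S : K[X])
    (hS : S.natDegree + P.natDegree ≤ N) : ell p (S * P) = 0 := by
  rw [← ell_cmp, ell_sum_range _ S (S.natDegree + 1) (Nat.lt_succ_self _)]
  refine Finset.sum_eq_zero fun i hi => ?_
  rw [Finset.mem_range] at hi
  rw [cmp, h i (by omega), mul_zero]

lemma natDegree_div_le' {F : Type*} [Field F] (p q : F[X]) (hq : q ≠ 0) :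
    (p / q).natDegree = p.natDegree - q.natDegree := by
  rw [Polynomial.div_def, natDegree_C_mul (by simpa using hq),
    natDegree_divByMonic _ (monic_mul_leadingCoeff_inv hq), natDegree_mul_leadingCoeff_inv _ hq]

lemma div_field {F : Type*} [Field F] {p : ℕ → F} {N : ℕ} {P R : F[X]} (hP0 : P ≠ 0)
    (hP : Kill p N P) (hmin : ∀ D, D ≠ 0 → Kill p N D → P.natDegree ≤ D.natDegree)
    (hR : Kill p N R) (hdeg : P.natDegree + R.natDegree ≤ N + 1) : P ∣ R := by
  rw [← EuclideanDomain.mod_eq_zero]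
  by_contra hne
  have hlt : (R % P).natDegree < P.natDegree ∨ P.natDegree = 0 := by
    by_cases h0 : P.natDegree = 0
    · exact Or.inr h0
    · exact Or.inl (natDegree_mod_lt _ h0)
  rcases hlt with hlt | h0
  swap
  · apply hne
    rw [EuclideanDomain.mod_eq_zero]
    rw [natDegree_eq_zero] at h0
    obtain ⟨c, rfl⟩ := h0
    have hc : c ≠ 0 := by rintro rfl; simp at hP0
    exact (isUnit_C.2 (isUnit_iff_ne_zero.2 hc)).dvd
  have hsmall : ∀ S : F[X], S.natDegree < P.natDegree → ell p (S * (R % P)) = 0 := by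
    intro S hS
    have e : S * (R % P) = S * R - (S * (R / P)) * P := by
      have := EuclideanDomain.div_add_mod R P
      linear_combination S * this
    rw [e, map_sub, hR.mul S (by omega), zero_sub, neg_eq_zero]
    by_cases hd : R.natDegree < P.natDegree
    · have : R / P = 0 := by
        rw [Polynomial.div_eq_zero_iff hP0]
        exact degree_lt_degree hd
      rw [this]; simp
    · apply hP.mul
      have h1 := natDegree_mul_le (p := S) (q := R / P)
      have h2 := natDegree_div_le' R P hP0
      omega
  have hk : Kill p N (R % P) := by
    intro j hj
    have e : X ^ j * (R % P) = ((X ^ j / P) * (R % P)) * P + (X ^ j % P) * (R % P) := by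
      have := EuclideanDomain.div_add_mod (X ^ j : F[X]) P
      linear_combination (- (R % P)) * this
    rw [e, map_add, hsmall _ (natDegree_mod_lt _ (by omega)), add_zero]
    by_cases hd : j < P.natDegree
    · have : (X ^ j : F[X]) / P = 0 := by
        rw [Polynomial.div_eq_zero_iff hP0]
        exact degree_lt_degree (by simpa using hd)
      rw [this]; simp
    · apply hP.mul
      have h1 := natDegree_mul_le (p := X ^ j / P) (q := R % P)
      have h2 := natDegree_div_le' (X ^ j : F[X]) P hP0
      rw [natDegree_X_pow] at h2
      omega
  exact absurd (hmin _ hne hk) (by omega)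

/-- minimal primitive annihilator -/
def IsMin (p : ℕ → ℤ) (N : ℕ) (P : ℤ[X]) : Prop :=
  P.IsPrimitive ∧ Kill p N P ∧ ∀ D, D ≠ 0 → Kill p N D → P.natDegree ≤ D.natDegree

lemma ell_map (p : ℕ → ℤ) (R : ℤ[X]) :
    ell (fun i => (p i : ℚ)) (R.map (Int.castRingHom ℚ)) = ((ell p R : ℤ) : ℚ) := by
  rw [ell_sum_range p R (R.natDegree + 1) (Nat.lt_succ_self _),
    ell_sum_range _ _ (R.natDegree + 1) (Nat.lt_succ_of_le natDegree_map_le)]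
  simp

lemma kill_map (p : ℕ → ℤ) (N : ℕ) (R : ℤ[X]) :
    Kill (fun i => (p i : ℚ)) N (R.map (Int.castRingHom ℚ)) ↔ Kill p N R := by
  unfold Kill
  have : (R.map (Int.castRingHom ℚ)).natDegree = R.natDegree :=
    natDegree_map_eq_of_injective (RingHom.injective_int _) R
  rw [this]
  refine forall_congr' fun j => imp_congr_right fun _ => ?_
  rw [show (X : ℚ[X]) ^ j * R.map (Int.castRingHom ℚ) = (X ^ j * R).map (Int.castRingHom ℚ) by simp,
    ell_map]
  norm_cast

lemma kill_smul {K : Type*} [CommRing K] [IsDomain K] {p : ℕ → K} {N : ℕ} {R : K[X]} {c : K}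
    (hc : c ≠ 0) : Kill p N (C c * R) ↔ Kill p N R := by
  unfold Kill
  rw [natDegree_C_mul hc]
  refine forall_congr' fun j => imp_congr_right fun _ => ?_
  rw [show X ^ j * (C c * R) = C c * (X ^ j * R) by ring, ← smul_eq_C_mul, map_smul]
  simp [hc]

lemma exists_isMin (p : ℕ → ℤ) (N : ℕ) : ∃ P, IsMin p N P := by
  classical
  have hex : ∃ d, ∃ D : ℤ[X], D ≠ 0 ∧ Kill p N D ∧ D.natDegree = d :=
    ⟨N + 1, X ^ (N + 1), by simp, fun j hj => by simp at hj; omega, by simp⟩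
  obtain ⟨D, hD0, hDk, hDd⟩ := Nat.find_spec hex
  have hc : D.content ≠ 0 := by simpa [content_eq_zero_iff] using hD0
  refine ⟨D.primPart, D.isPrimitive_primPart, ?_, ?_⟩
  · rw [D.eq_C_content_mul_primPart] at hDk
    exact (kill_smul hc).1 hDk
  · intro R hR hk
    rw [natDegree_primPart, hDd]
    exact Nat.find_min' hex ⟨R, hR, hk, rfl⟩

lemma IsMin.dvd {p : ℕ → ℤ} {N : ℕ} {P R : ℤ[X]} (hP : IsMin p N P) (hR : Kill p N R)
    (hdeg : P.natDegree + R.natDegree ≤ N + 1) : P ∣ R := by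
  obtain ⟨hprim, hk, hmin⟩ := hP
  have hinj : Function.Injective (Int.castRingHom ℚ) := RingHom.injective_int _
  have key : P.map (Int.castRingHom ℚ) ∣ R.map (Int.castRingHom ℚ) := by
    apply div_field (p := fun i => (p i : ℚ)) (N := N)
    · rw [Ne, Polynomial.map_eq_zero_iff hinj]; exact hprim.ne_zero
    · exact (kill_map _ _ _).2 hk
    · intro D hD hDk
      obtain ⟨b, hbm, hb⟩ := IsLocalization.integerNormalization_spec (nonZeroDivisors ℤ) D
      set D2 := IsLocalization.integerNormalization (nonZeroDivisors ℤ) D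
      have hb0 : (b : ℚ) ≠ 0 := by
        have := nonZeroDivisors.ne_zero hbm
        exact_mod_cast this
      have hb2 : D2.map (Int.castRingHom ℚ) = C (b : ℚ) * D := by
        rw [← smul_eq_C_mul]
        have e : algebraMap ℤ ℚ = Int.castRingHom ℚ := rfl
        rw [← e, hb]
        ext i
        simp
      have hD2k : Kill p N D2 := by
        rw [← kill_map, hb2, kill_smul hb0]; exact hDk
      have hD2 : D2 ≠ 0 := by
        intro h
        rw [h] at hb2
        rw [Polynomial.map_zero] at hb2
        exact (mul_ne_zero (by simpa using hb0) hD) hb2.symm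
      have h1 := hmin D2 hD2 hD2k
      have h2 : (D2.map (Int.castRingHom ℚ)).natDegree = D2.natDegree :=
        natDegree_map_eq_of_injective hinj D2
      rw [hb2, natDegree_C_mul hb0] at h2
      rw [natDegree_map_eq_of_injective hinj]
      omega
    · exact (kill_map _ _ _).2 hR
    · rw [natDegree_map_eq_of_injective hinj, natDegree_map_eq_of_injective hinj]; exact hdeg
  exact (IsPrimitive.Int.dvd_iff_map_cast_dvd_map_cast _ _ hprim).2 key

lemma isPrimitive_of_mul {F G : ℤ[X]} (h : (F * G).IsPrimitive) : F.IsPrimitive := by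
  intro r hr
  exact h r (hr.trans (dvd_mul_right _ _))

lemma kill_cmp {p : ℕ → ℤ} {N : ℕ} {F G : ℤ[X]} (hF : F ≠ 0) (hG : G ≠ 0) (hN : G.natDegree ≤ N) :
    Kill (cmp p G) (N - G.natDegree) F ↔ Kill p N (F * G) := by
  unfold Kill
  rw [natDegree_mul hF hG]
  refine forall_congr' fun j => ?_
  rw [ell_cmp, mul_assoc]
  refine imp_congr (by omega) Iff.rfl

lemma IsMin.factor {p : ℕ → ℤ} {N : ℕ} {F G : ℤ[X]} (h : IsMin p N (F * G))
    (hN : G.natDegree ≤ N) : IsMin (cmp p G) (N - G.natDegree) F := by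
  have h0 := h.1.ne_zero
  have hF : F ≠ 0 := left_ne_zero_of_mul h0
  have hG : G ≠ 0 := right_ne_zero_of_mul h0
  refine ⟨isPrimitive_of_mul h.1, (kill_cmp hF hG hN).2 h.2.1, fun D hD hk => ?_⟩
  have := h.2.2 (D * G) (mul_ne_zero hD hG) ((kill_cmp hD hG hN).1 hk)
  rw [natDegree_mul hF hG, natDegree_mul hD hG] at this
  omega

lemma isMin_of_irreducible {p : ℕ → ℤ} {N : ℕ} {f : ℤ[X]} (hf : Irreducible f)
    (hd : f.natDegree ≠ 0) (hk : Kill p N f) (hN : 2 * f.natDegree ≤ N + 1)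
    (hp : ∃ i, i ≤ N ∧ p i ≠ 0) : IsMin p N f := by
  obtain ⟨P, hP⟩ := exists_isMin p N
  have hle := hP.2.2 f hf.ne_zero hk
  obtain ⟨S, hS⟩ := hP.dvd hk (by omega)
  rcases hf.isUnit_or_isUnit hS with hu | hu
  · exfalso
    obtain ⟨i, hi, hpi⟩ := hp
    apply hpi
    have hd0 : P.natDegree = 0 := natDegree_eq_zero_of_isUnit hu
    obtain ⟨V, hV⟩ := hu.exists_right_inv
    have hVd : V.natDegree = 0 := natDegree_eq_zero_of_isUnit (IsUnit.of_mul_eq_one P (by rw [mul_comm]; exact hV))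
    have h1 := hP.2.1.mul (X ^ i * V) (by
      have := natDegree_mul_le (p := (X : ℤ[X]) ^ i) (q := V)
      rw [natDegree_X_pow] at this; omega)
    rw [mul_assoc, mul_comm V P, hV, mul_one, ell_X_pow] at h1
    exact h1
  · have hSd : S.natDegree = 0 := natDegree_eq_zero_of_isUnit hu
    have hdeg : f.natDegree = P.natDegree := by
      rw [hS, natDegree_mul hP.1.ne_zero hu.ne_zero, hSd, add_zero]
    exact ⟨hf.isPrimitive hd, hk, fun D hD hDk => hdeg ▸ hP.2.2 D hD hDk⟩

end
end SimDioph

namespace SimDioph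
open Polynomial

noncomputable section

/-- Mahler measure of an integer polynomial -/
def hh (P : ℤ[X]) : ℝ := (P.map (Int.castRingHom ℂ)).mahlerMeasure

lemma hh_mul (P Q : ℤ[X]) : hh (P * Q) = hh P * hh Q := by
  simp [hh, mahlerMeasure_mul]

lemma hh_nonneg (P : ℤ[X]) : 0 ≤ hh P := mahlerMeasure_nonneg _

lemma one_le_hh {P : ℤ[X]} (hP : P ≠ 0) : 1 ≤ hh P := by
  apply one_le_mahlerMeasure_of_one_le_norm_leadingCoeff
  rw [leadingCoeff_map_of_injective (RingHom.injective_int _)]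
  have : P.leadingCoeff ≠ 0 := by simpa using hP
  simp only [eq_intCast, Complex.norm_intCast]
  exact_mod_cast Int.one_le_abs this

lemma coeff_le_hh (P : ℤ[X]) (n : ℕ) (hn : P.natDegree ≤ n) (i : ℕ) :
    |(P.coeff i : ℝ)| ≤ 2 ^ n * hh P := by
  have h := norm_coeff_le_choose_mul_mahlerMeasure i (P.map (Int.castRingHom ℂ))
  rw [coeff_map, eq_intCast, Complex.norm_intCast,
    natDegree_map_eq_of_injective (RingHom.injective_int _)] at h
  refine h.trans (mul_le_mul_of_nonneg_right ?_ (hh_nonneg P))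
  calc ((P.natDegree.choose i : ℕ) : ℝ) ≤ ((2 ^ P.natDegree : ℕ) : ℝ) := by
        exact_mod_cast Nat.choose_le_two_pow _ _
    _ ≤ 2 ^ n := by
        push_cast
        exact pow_le_pow_right₀ (by norm_num) hn

lemma hh_le (P : ℤ[X]) (k : ℕ) (hk : P.natDegree ≤ k) (T : ℝ)
    (hT : ∀ i, |(P.coeff i : ℝ)| ≤ T) : hh P ≤ (k + 1) * T := by
  have h := mahlerMeasure_le_sum_norm_coeff (P.map (Int.castRingHom ℂ))
  refine h.trans ?_
  rw [Polynomial.sum_over_range' _ (by simp) (k + 1)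
    (Nat.lt_succ_of_le (natDegree_map_le.trans hk))]
  calc _ ≤ ∑ i ∈ Finset.range (k + 1), T := by
        refine Finset.sum_le_sum fun i _ => ?_
        rw [coeff_map, eq_intCast, Complex.norm_intCast]
        exact hT i
    _ = _ := by simp

lemma hh_isUnit {P : ℤ[X]} (h : IsUnit P) : hh P = 1 := by
  obtain ⟨V, hV⟩ := h.exists_right_inv
  have hV0 : V ≠ 0 := by rintro rfl; simp at hV
  have h1 := one_le_hh h.ne_zero
  have h2 := one_le_hh hV0
  have h3 : hh P * hh V = 1 := by
    rw [← hh_mul, hV]; simp [hh]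
  nlinarith

end
end SimDioph

namespace SimDioph
open Polynomial

noncomputable section

lemma pow_abs_le {x B : ℝ} {n i : ℕ} (hB : 1 ≤ B) (hx : |x| ≤ B) (hi : i ≤ n) : |x ^ i| ≤ B ^ n := by
  rw [abs_pow]
  exact (pow_le_pow_left₀ (abs_nonneg _) hx i).trans (pow_le_pow_right₀ hB hi)

lemma aeval_abs_le {x B T : ℝ} {n k : ℕ} (hB : 1 ≤ B) (hx : |x| ≤ B) (hk : k ≤ n) (R : ℤ[X])
    (hR : R.natDegree < k + 1) (hT : ∀ i, |(R.coeff i : ℝ)| ≤ T) :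
    |aeval x R| ≤ (n + 1) * B ^ n * T := by
  have hT0 : 0 ≤ T := (abs_nonneg _).trans (hT 0)
  have hW : 0 ≤ B ^ n := by positivity
  rw [aeval_eq_sum_range' hR]
  calc _ ≤ ∑ i ∈ Finset.range (k + 1), |R.coeff i • x ^ i| := Finset.abs_sum_le_sum_abs _ _
    _ ≤ ∑ i ∈ Finset.range (k + 1), B ^ n * T := by
        refine Finset.sum_le_sum fun i hi => ?_
        rw [Finset.mem_range] at hi
        rw [zsmul_eq_mul, abs_mul, mul_comm]
        exact mul_le_mul (pow_abs_le hB hx (by omega)) (hT i) (abs_nonneg _) hW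
    _ = (k + 1) * (B ^ n * T) := by simp
    _ ≤ (n + 1) * (B ^ n * T) := by gcongr
    _ = _ := by ring

lemma ell_approx {x B T E E1 σ : ℝ} {n N k : ℕ} (hB : 1 ≤ B) (hx : |x| ≤ B) (hk : k ≤ N)
    (hN : N ≤ n) (p : ℕ → ℤ) (hσ : |σ| ≤ E1)
    (hp : ∀ i ≤ N, |(p i : ℝ) - x ^ i * p 0 - i * x ^ (i - 1) * σ| ≤ E) (R : ℤ[X])
    (hR : R.natDegree < k + 1) (hT : ∀ i, |(R.coeff i : ℝ)| ≤ T) :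
    |(ell p R : ℝ) - p 0 * aeval x R| ≤ (n + 1) * T * (E + n * B ^ n * E1) := by
  have hT0 : 0 ≤ T := (abs_nonneg _).trans (hT 0)
  have hE0 : 0 ≤ E := (abs_nonneg _).trans (hp 0 (Nat.zero_le _))
  have hE10 : 0 ≤ E1 := (abs_nonneg _).trans hσ
  have hW : 0 ≤ B ^ n := by positivity
  rw [aeval_eq_sum_range' hR, ell_sum_range _ _ _ hR]
  push_cast
  rw [Finset.mul_sum, ← Finset.sum_sub_distrib]
  calc _ ≤ ∑ i ∈ Finset.range (k + 1), |(R.coeff i : ℝ) * (p i : ℝ) - p 0 * R.coeff i • x ^ i| :=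
        Finset.abs_sum_le_sum_abs _ _
    _ ≤ ∑ i ∈ Finset.range (k + 1), T * (E + n * B ^ n * E1) := by
        refine Finset.sum_le_sum fun i hi => ?_
        rw [Finset.mem_range] at hi
        have e : (R.coeff i : ℝ) * (p i : ℝ) - p 0 * R.coeff i • x ^ i
          = R.coeff i * (((p i : ℝ) - x ^ i * p 0 - i * x ^ (i - 1) * σ) + i * x ^ (i - 1) * σ) := by
          rw [zsmul_eq_mul]; ring
        rw [e, abs_mul]
        refine mul_le_mul (hT i) ?_ (abs_nonneg _) hT0
        refine (abs_add_le _ _).trans (add_le_add (hp i (by omega)) ?_)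
        rw [abs_mul, abs_mul, Nat.abs_cast]
        have hi' : (i : ℝ) ≤ n := by exact_mod_cast (by omega : i ≤ n)
        have := pow_abs_le (n := n) (i := i - 1) hB hx (by omega)
        gcongr
    _ = (k + 1) * (T * (E + n * B ^ n * E1)) := by simp
    _ ≤ (n + 1) * (T * (E + n * B ^ n * E1)) := by
        have : (k : ℝ) ≤ n := by exact_mod_cast hk.trans hN
        gcongr
    _ = _ := by ring

lemma ell_shift {x B T E E1 σ B0 : ℝ} {n N j : ℕ} (hB : 1 ≤ B) (hx : |x| ≤ B)
    (hN : N ≤ n) (p : ℕ → ℤ) (hσ : |σ| ≤ E1)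
    (hp : ∀ i ≤ N, |(p i : ℝ) - x ^ i * p 0 - i * x ^ (i - 1) * σ| ≤ E) (D : ℤ[X])
    (hD : j + D.natDegree ≤ N) (hT : ∀ i, |(D.coeff i : ℝ)| ≤ T)
    (h0 : ell p D = 0) (hB0 : |aeval x D| ≤ B0) :
    |(ell p (X ^ j * D) : ℝ)| ≤ n * B ^ n * E1 * B0 + 2 * (n + 1) * B ^ n * T * E := by
  have hT0 : 0 ≤ T := (abs_nonneg _).trans (hT 0)
  have hE0 : 0 ≤ E := (abs_nonneg _).trans (hp 0 (Nat.zero_le _))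
  have hE10 : 0 ≤ E1 := (abs_nonneg _).trans hσ
  have hB00 : 0 ≤ B0 := (abs_nonneg _).trans hB0
  have hW : 1 ≤ B ^ n := one_le_pow₀ hB
  have hlt : D.natDegree < D.natDegree + 1 := Nat.lt_succ_self _
  have e : (ell p (X ^ j * D) : ℝ) = j * x ^ (j - 1) * σ * aeval x D
      + ∑ i ∈ Finset.range (D.natDegree + 1), (D.coeff i : ℝ) *
        (((p (i + j) : ℝ) - x ^ (i + j) * p 0 - ((i + j : ℕ) : ℝ) * x ^ (i + j - 1) * σ)
          - x ^ j * ((p i : ℝ) - x ^ i * p 0 - i * x ^ (i - 1) * σ)) := by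
    have h1 : (ell p (X ^ j * D) : ℝ) = (ell p (X ^ j * D) : ℝ) - x ^ j * (ell p D : ℝ) := by
      rw [h0]; simp
    rw [h1, ell_X_pow_mul _ _ _ _ hlt, ell_sum_range _ _ _ hlt, aeval_eq_sum_range' hlt]
    push_cast
    rw [Finset.mul_sum, Finset.mul_sum, ← Finset.sum_sub_distrib, ← Finset.sum_add_distrib]
    refine Finset.sum_congr rfl fun i _ => ?_
    rw [zsmul_eq_mul]
    rcases j with _ | j
    · simp
    · rcases i with _ | i
      · simp; ring
      · simp only [Nat.add_sub_cancel, show i + 1 + (j + 1) - 1 = i + j + 1 by omega]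
        push_cast
        ring
  rw [e]
  refine (abs_add_le _ _).trans (add_le_add ?_ ?_)
  · rw [abs_mul, abs_mul, abs_mul, Nat.abs_cast]
    have hi' : (j : ℝ) ≤ n := by exact_mod_cast (by omega : j ≤ n)
    have := pow_abs_le (n := n) (i := j - 1) hB hx (by omega)
    gcongr
  · calc _ ≤ ∑ i ∈ Finset.range (D.natDegree + 1), |(D.coeff i : ℝ) *
        (((p (i + j) : ℝ) - x ^ (i + j) * p 0 - ((i + j : ℕ) : ℝ) * x ^ (i + j - 1) * σ)
          - x ^ j * ((p i : ℝ) - x ^ i * p 0 - i * x ^ (i - 1) * σ))| :=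
          Finset.abs_sum_le_sum_abs _ _
      _ ≤ ∑ i ∈ Finset.range (D.natDegree + 1), T * (2 * B ^ n * E) := by
          refine Finset.sum_le_sum fun i hi => ?_
          rw [Finset.mem_range] at hi
          rw [abs_mul]
          refine mul_le_mul (hT i) ?_ (abs_nonneg _) hT0
          refine (abs_sub _ _).trans ?_
          rw [abs_mul]
          have a1 := hp (i + j) (by omega)
          have a2 := hp i (by omega)
          have a3 := pow_abs_le (n := n) (i := j) hB hx (by omega)
          have a4 := mul_le_mul a3 a2 (abs_nonneg _) (by positivity)
          nlinarith
      _ = (D.natDegree + 1) * (T * (2 * B ^ n * E)) := by simp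
      _ ≤ (n + 1) * (T * (2 * B ^ n * E)) := by
          have : (D.natDegree : ℝ) ≤ n := by exact_mod_cast (by omega : D.natDegree ≤ n)
          gcongr
      _ = _ := by ring

lemma mem_Icc_of_abs {z : ℤ} {A : ℝ} (h : |(z : ℝ)| ≤ A) :
    z ∈ Finset.Icc (-(⌊A⌋₊ : ℤ)) (⌊A⌋₊ : ℤ) := by
  rw [Finset.mem_Icc]
  have h1 : ((z.natAbs : ℕ) : ℝ) ≤ A := by
    rw [Nat.cast_natAbs]; exact_mod_cast h
  have := Nat.le_floor h1
  omega

lemma card_Icc_le {A : ℝ} (h : 0 ≤ A) :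
    ((Finset.Icc (-(⌊A⌋₊ : ℤ)) (⌊A⌋₊ : ℤ)).card : ℝ) ≤ 2 * A + 1 := by
  rw [Int.card_Icc]
  have h1 : ((⌊A⌋₊ : ℤ) + 1 - -(⌊A⌋₊ : ℤ)).toNat = 2 * ⌊A⌋₊ + 1 := by omega
  rw [h1]
  push_cast
  linarith [Nat.floor_le h]

lemma ph_core {x B E E1 σ B0 U : ℝ} {n N k T : ℕ} (hB : 1 ≤ B) (hx : |x| ≤ B)
    (hk : k ≤ N) (hN : N ≤ n) (p : ℕ → ℤ) (hσ : |σ| ≤ E1) (hU : |(p 0 : ℝ)| ≤ U)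
    (hp : ∀ i ≤ N, |(p i : ℝ) - x ^ i * p 0 - i * x ^ (i - 1) * σ| ≤ E) (hB0 : 0 < B0)
    (P : ℤ[X]) (hP : P ≠ 0)
    (hdiv : ∀ D : ℤ[X], D ≠ 0 → D.natDegree ≤ k → Kill p N D → P ∣ D)
    (hsm : n * B ^ n * E1 * B0 + 2 * (n + 1) * B ^ n * T * E < 1) :
    (T : ℝ) ^ (k + 1) ≤ (2 * (2 ^ n * ((n + 1) * T / hh P)) + 1) ^ (k + 1 - P.natDegree) *
      ((2 * ((n + 1) * B ^ n * T / B0 + 1) + 1) *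
        (2 * ((n + 1) * T * (E + n * B ^ n * E1) + U * B0 + 1) + 1)) := by
  classical
  have hE0 : 0 ≤ E := (abs_nonneg _).trans (hp 0 (Nat.zero_le _))
  have hE10 : 0 ≤ E1 := (abs_nonneg _).trans hσ
  have hU0 : 0 ≤ U := (abs_nonneg _).trans hU
  have hW : 1 ≤ B ^ n := one_le_pow₀ hB
  have hhP := one_le_hh hP
  set V : Finset (Fin (k + 1) → ℤ) := Fintype.piFinset fun _ => Finset.Ico (0 : ℤ) T with hV
  have hVcard : V.card = T ^ (k + 1) := by simp [hV]
  have hcoef : ∀ v ∈ V, ∀ i, 0 ≤ (ofFn (k + 1) v).coeff i ∧ (ofFn (k + 1) v).coeff i ≤ T := by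
    intro v hv i
    rw [hV, Fintype.mem_piFinset] at hv
    by_cases hi : i < k + 1
    · rw [ofFn_coeff_eq_val_of_lt v hi]
      have := Finset.mem_Ico.1 (hv ⟨i, hi⟩)
      exact ⟨this.1, this.2.le⟩
    · rw [ofFn_coeff_eq_zero_of_ge v (by omega)]
      exact ⟨le_rfl, by positivity⟩
  have hdeg : ∀ v : Fin (k + 1) → ℤ, (ofFn (k + 1) v).natDegree < k + 1 :=
    fun v => ofFn_natDegree_lt (by omega) v
  set A1 : ℝ := (n + 1) * B ^ n * T / B0 + 1 with hA1
  set A2 : ℝ := (n + 1) * T * (E + n * B ^ n * E1) + U * B0 + 1 with hA2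
  set A3 : ℝ := 2 ^ n * ((n + 1) * T / hh P) with hA3
  have hA10 : 0 ≤ A1 := by positivity
  have hA20 : 0 ≤ A2 := by positivity
  have hA30 : 0 ≤ A3 := by positivity
  let bb : (Fin (k + 1) → ℤ) → ℤ := fun v => ⌊aeval x (ofFn (k + 1) v) / B0⌋
  let φ : (Fin (k + 1) → ℤ) → ℤ × ℤ := fun v =>
    (bb v, ell p (ofFn (k + 1) v) - ⌊(p 0 : ℝ) * (bb v * B0)⌋)
  set t : Finset (ℤ × ℤ) := Finset.Icc (-(⌊A1⌋₊ : ℤ)) (⌊A1⌋₊ : ℤ) ×ˢ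
    Finset.Icc (-(⌊A2⌋₊ : ℤ)) (⌊A2⌋₊ : ℤ) with ht
  have hbb1 : ∀ v, (bb v : ℝ) * B0 ≤ aeval x (ofFn (k + 1) v) := fun v => by
    have := Int.floor_le (aeval x (ofFn (k + 1) v) / B0)
    rwa [le_div_iff₀ hB0] at this
  have hbb2 : ∀ v, aeval x (ofFn (k + 1) v) < (bb v : ℝ) * B0 + B0 := fun v => by
    have := Int.lt_floor_add_one (aeval x (ofFn (k + 1) v) / B0)
    rw [div_lt_iff₀ hB0] at this
    linarith
  have hmaps : ∀ v ∈ V, φ v ∈ t := by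
    intro v hv
    have hT : ∀ i, |((ofFn (k + 1) v).coeff i : ℝ)| ≤ T := fun i => by
      obtain ⟨h1, h2⟩ := hcoef v hv i
      rw [abs_of_nonneg (by exact_mod_cast h1)]
      exact_mod_cast h2
    rw [ht, Finset.mem_product]
    constructor
    · apply mem_Icc_of_abs
      have h1 := aeval_abs_le hB hx (hk.trans hN) _ (hdeg v) hT
      have h2 : |aeval x (ofFn (k + 1) v) / B0| ≤ (n + 1) * B ^ n * T / B0 := by
        rw [abs_div, abs_of_pos hB0]; gcongr
      have h3 := Int.floor_le (aeval x (ofFn (k + 1) v) / B0)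
      have h4 := Int.lt_floor_add_one (aeval x (ofFn (k + 1) v) / B0)
      rw [abs_le] at h2 ⊢
      simp only [φ, bb, hA1]
      constructor <;> linarith
    · apply mem_Icc_of_abs
      have h1 := ell_approx hB hx hk hN p hσ hp _ (hdeg v) hT
      have h3 := Int.floor_le ((p 0 : ℝ) * (bb v * B0))
      have h4 := Int.lt_floor_add_one ((p 0 : ℝ) * (bb v * B0))
      have h5 : |(p 0 : ℝ) * (aeval x (ofFn (k + 1) v) - bb v * B0)| ≤ U * B0 := by
        rw [abs_mul]
        have h6 : |aeval x (ofFn (k + 1) v) - bb v * B0| ≤ B0 := by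
          rw [abs_le]; constructor <;> linarith [hbb1 v, hbb2 v]
        exact mul_le_mul hU h6 (abs_nonneg _) hU0
      simp only [φ, hA2]
      push_cast
      rw [mul_sub] at h5
      rw [abs_le] at h1 h5 ⊢
      constructor <;> linarith [h1.1, h1.2, h5.1, h5.2]
  set F : ℕ := (2 * ⌊A3⌋₊ + 1) ^ (k + 1 - P.natDegree) with hF
  have hfib : ∀ y ∈ t, (V.filter fun v => φ v = y).card ≤ F := by
    intro y _
    rcases (V.filter fun v => φ v = y).eq_empty_or_nonempty with he | ⟨v0, hv0⟩
    · rw [he]; simp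
    rw [Finset.mem_filter] at hv0
    have hkey : ∀ v ∈ V.filter (fun v => φ v = y), ∃ S : ℤ[X],
        ofFn (k + 1) v - ofFn (k + 1) v0 = P * S ∧ (∀ i, |(S.coeff i : ℝ)| ≤ A3) ∧
        (∀ i, k + 1 - P.natDegree ≤ i → S.coeff i = 0) := by
      intro v hv
      rw [Finset.mem_filter] at hv
      set D := ofFn (k + 1) v - ofFn (k + 1) v0 with hD
      by_cases hD0 : D = 0
      · exact ⟨0, by simp [hD0], by simpa using hA30, by simp⟩
      have hφ : φ v = φ v0 := hv.2.trans hv0.2.symm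
      have hb : bb v = bb v0 := congrArg Prod.fst hφ
      have hl : ell p (ofFn (k + 1) v) - ⌊(p 0 : ℝ) * (bb v * B0)⌋ =
        ell p (ofFn (k + 1) v0) - ⌊(p 0 : ℝ) * (bb v0 * B0)⌋ := congrArg Prod.snd hφ
      rw [hb] at hl
      have hell : ell p D = 0 := by rw [hD, map_sub]; omega
      have hDx : |aeval x D| ≤ B0 := by
        rw [hD, map_sub, abs_le]
        have h1 := hbb1 v; have h2 := hbb2 v; have h3 := hbb1 v0; have h4 := hbb2 v0
        rw [hb] at h1 h2
        constructor <;> linarith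
      have hT : ∀ i, |(D.coeff i : ℝ)| ≤ T := fun i => by
        obtain ⟨h1, h2⟩ := hcoef v hv.1 i
        obtain ⟨h3, h4⟩ := hcoef v0 hv0.1 i
        have : |D.coeff i| ≤ (T : ℤ) := by
          rw [hD, coeff_sub, abs_le]; constructor <;> omega
        exact_mod_cast this
      have hDdeg : D.natDegree ≤ k := by
        have h1 := natDegree_sub_le (ofFn (k + 1) v) (ofFn (k + 1) v0)
        have h2 := hdeg v
        have h3 := hdeg v0
        rw [← hD] at h1
        have := max_lt h2 h3
        omega
      have hkill : Kill p N D := by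
        intro j hj
        have h1 := ell_shift hB hx hN p hσ hp D hj hT hell hDx
        have h2 : |(ell p (X ^ j * D) : ℝ)| < 1 := h1.trans_lt hsm
        have h3 : |ell p (X ^ j * D)| < 1 := by exact_mod_cast h2
        exact Int.abs_lt_one_iff.1 h3
      obtain ⟨S, hS⟩ := hdiv D hD0 hDdeg hkill
      have hS0 : S ≠ 0 := by rintro rfl; simp at hS; exact hD0 hS
      have hdd : D.natDegree = P.natDegree + S.natDegree := by rw [hS, natDegree_mul hP hS0]
      refine ⟨S, hS, fun i => ?_, fun i hi => ?_⟩
      · refine (coeff_le_hh S n (by omega) i).trans ?_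
        rw [hA3]
        gcongr
        rw [le_div_iff₀ (by linarith), mul_comm, ← hh_mul, ← hS]
        refine (hh_le D n (by omega) T hT)
      · exact coeff_eq_zero_of_natDegree_lt (by omega)
    choose! S hS using hkey
    have hinj : (V.filter fun v => φ v = y).card ≤ (Fintype.piFinset fun _ : Fin (k + 1 - P.natDegree) =>
        Finset.Icc (-(⌊A3⌋₊ : ℤ)) (⌊A3⌋₊ : ℤ)).card := by
      apply Finset.card_le_card_of_injOn (fun v (i : Fin (k + 1 - P.natDegree)) => (S v).coeff (i : ℕ))
      · intro v hv
        rw [Finset.mem_coe] at hv ⊢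
        rw [Fintype.mem_piFinset]
        intro i
        exact mem_Icc_of_abs ((hS v hv).2.1 i)
      · intro v hv w hw hvw
        rw [Finset.mem_coe] at hv hw
        have hSS : S v = S w := by
          ext i
          by_cases hi : i < k + 1 - P.natDegree
          · exact congrFun hvw ⟨i, hi⟩
          · rw [(hS v hv).2.2 i (by omega), (hS w hw).2.2 i (by omega)]
        have h1 := (hS v hv).1
        have h2 := (hS w hw).1
        rw [hSS, ← h2] at h1
        exact injective_ofFn _ (sub_left_injective h1)
    refine hinj.trans (le_of_eq ?_)
    rw [Fintype.card_piFinset_const, Int.card_Icc, hF]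
    congr 1
    omega
  have hfin := Finset.card_le_mul_card_image_of_maps_to hmaps F hfib
  rw [hVcard, ht, Finset.card_product] at hfin
  have hfin' : (T : ℝ) ^ (k + 1) ≤ (F : ℝ) * (((Finset.Icc (-(⌊A1⌋₊ : ℤ)) (⌊A1⌋₊ : ℤ)).card : ℝ) *
    ((Finset.Icc (-(⌊A2⌋₊ : ℤ)) (⌊A2⌋₊ : ℤ)).card : ℝ)) := by exact_mod_cast hfin
  refine hfin'.trans ?_
  have hFle : (F : ℝ) ≤ (2 * A3 + 1) ^ (k + 1 - P.natDegree) := by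
    rw [hF]; push_cast
    have := Nat.floor_le hA30
    gcongr
  have h1 := card_Icc_le hA10
  have h2 := card_Icc_le hA20
  gcongr

set_option maxHeartbeats 1600000 in
lemma ph_main (n : ℕ) (B : ℝ) (hB : 1 ≤ B) : ∃ C : ℝ, 1 ≤ C ∧ ∀ (x E E1 σ U : ℝ) (N k : ℕ)
    (p : ℕ → ℤ) (P : ℤ[X]), |x| ≤ B → k ≤ N → N ≤ n → |σ| ≤ E1 → |(p 0 : ℝ)| ≤ U →
    0 < E → E ≤ E1 → C * E ≤ 1 →
    (∀ i ≤ N, |(p i : ℝ) - x ^ i * p 0 - i * x ^ (i - 1) * σ| ≤ E) → P ≠ 0 →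
    (∀ D : ℤ[X], D ≠ 0 → D.natDegree ≤ k → Kill p N D → P ∣ D) →
    (1 / E) ^ k ≤ C * (U + E1 ^ 2 / E) * (max 1 (1 / (E * hh P))) ^ (k + 1 - P.natDegree) := by
  have hW : 1 ≤ B ^ n := one_le_pow₀ hB
  set K : ℝ := (n + 1) * B ^ n with hK
  have hK1 : 1 ≤ K := by
    have : (1 : ℝ) ≤ n + 1 := by linarith [Nat.cast_nonneg (α := ℝ) n]
    nlinarith
  have hKn : (n : ℝ) + 1 ≤ K := by
    have : (0 : ℝ) ≤ n + 1 := by positivity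
    nlinarith
  have hKn2 : 1 + n * B ^ n ≤ K := by rw [hK]; linarith
  set M : ℝ := 2 ^ (n + 1) * K + 1 with hM
  have hM1 : 1 ≤ M := by
    rw [hM]; have : 0 ≤ 2 ^ (n + 1) * K := by positivity
    linarith
  refine ⟨(16 * K) ^ (n + 1) * (55 * K ^ 4) * M ^ (n + 1), ?_, ?_⟩
  · have h1 : 1 ≤ (16 * K) ^ (n + 1) := one_le_pow₀ (by linarith)
    have h2 : 1 ≤ 55 * K ^ 4 := by
      have := one_le_pow₀ (n := 4) hK1
      linarith
    have h3 : 1 ≤ M ^ (n + 1) := one_le_pow₀ hM1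
    have := one_le_mul_of_one_le_of_one_le h1 h2
    exact one_le_mul_of_one_le_of_one_le this h3
  intro x E E1 σ U N k p P hx hk hN hσ hU hE hEE hCE hp hP hdiv
  have hE1 : 0 < E1 := hE.trans_le hEE
  have hU0 : 0 ≤ U := (abs_nonneg _).trans hU
  have hhP := one_le_hh hP
  have h16 : 16 * K * E ≤ 1 := by
    refine le_trans (mul_le_mul_of_nonneg_right ?_ hE.le) hCE
    have h1 : 16 * K ≤ (16 * K) ^ (n + 1) := le_self_pow₀ (by linarith) (by omega)
    have h2 : 1 ≤ 55 * K ^ 4 := by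
      have := one_le_pow₀ (n := 4) hK1
      linarith
    have h3 : 1 ≤ M ^ (n + 1) := one_le_pow₀ hM1
    calc 16 * K ≤ (16 * K) ^ (n + 1) := h1
      _ = (16 * K) ^ (n + 1) * 1 * 1 := by ring
      _ ≤ _ := by gcongr
  set t : ℝ := 1 / E with ht
  have htE : t * E = 1 := by rw [ht]; field_simp
  have ht0 : 0 < t := by positivity
  have ht16 : 16 * K ≤ t := by rw [ht, le_div_iff₀ hE]; exact h16
  set T : ℕ := ⌊t / (8 * K)⌋₊ with hT
  have hT1 : (T : ℝ) ≤ t / (8 * K) := Nat.floor_le (by positivity)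
  have hT2 : t / (8 * K) < T + 1 := Nat.lt_floor_add_one _
  have hT3 : t / (16 * K) ≤ T := by
    have : t / (8 * K) = 2 * (t / (16 * K)) := by field_simp; norm_num
    have h2 : 1 ≤ t / (16 * K) := by rw [le_div_iff₀ (by positivity)]; linarith
    linarith
  have hTK : 8 * K * T ≤ t := by
    rw [le_div_iff₀ (by positivity)] at hT1; linarith
  have hTt : (T : ℝ) ≤ t := by
    have : (0:ℝ) ≤ T := by positivity
    nlinarith
  have hcore := ph_core (B0 := 1 / (4 * K * E1)) (T := T) hB hx hk hN p hσ hU hp (by positivity) P hP hdiv (by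
    have h1 : n * B ^ n * E1 * (1 / (4 * K * E1)) ≤ 1 / 4 := by
      have : n * B ^ n * E1 * (1 / (4 * K * E1)) = (n * B ^ n) / (4 * K) := by field_simp
      rw [this, div_le_div_iff₀ (by positivity) (by norm_num)]
      linarith
    have h2 : 2 * (n + 1) * B ^ n * T * E ≤ 1 / 4 := by
      have : 2 * (n + 1) * B ^ n * T * E = (8 * K * T) * E / 4 := by rw [hK]; ring
      rw [this]
      nlinarith
    linarith)
  have htE1 : 1 ≤ t * E1 := by rw [← htE]; gcongr
  have hK2 : 1 ≤ K ^ 2 := one_le_pow₀ hK1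
  have b1 : 2 * ((n + 1) * B ^ n * T / (1 / (4 * K * E1)) + 1) + 1 ≤ 11 * K ^ 2 * (t * E1) := by
    have e : (n + 1) * B ^ n * T / (1 / (4 * K * E1)) = 4 * K ^ 2 * (T * E1) := by
      rw [← hK]; field_simp
    rw [e]
    have h1 : (T : ℝ) * E1 ≤ t * E1 := by gcongr
    have h2 := mul_le_mul_of_nonneg_left h1 (by positivity : (0:ℝ) ≤ K ^ 2)
    have h6 := mul_le_mul_of_nonneg_right hK2 (by linarith : 0 ≤ t * E1)
    linarith
  have b2 : 2 * ((n + 1) * T * (E + n * B ^ n * E1) + U * (1 / (4 * K * E1)) + 1) + 1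
      ≤ 5 * K ^ 2 * (t * E1 + U / E1) := by
    have h1 : (n + 1) * T * (E + n * B ^ n * E1) ≤ K ^ 2 * (t * E1) := by
      have h2 : E + n * B ^ n * E1 ≤ K * E1 := by
        have := mul_le_mul_of_nonneg_right hKn2 hE1.le
        linarith
      calc (n + 1) * T * (E + n * B ^ n * E1) ≤ K * t * (K * E1) := by gcongr
        _ = _ := by ring
    have h3 : U * (1 / (4 * K * E1)) ≤ U / E1 := by
      rw [mul_one_div]
      gcongr
      have := mul_le_mul_of_nonneg_right hK1 hE1.le
      linarith
    have h4 : 0 ≤ U / E1 := by positivity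
    have h5 := mul_le_mul_of_nonneg_right hK2 h4
    have h6 := mul_le_mul_of_nonneg_right hK2 (by linarith : 0 ≤ t * E1)
    linarith
  have b3 : 2 * (2 ^ n * ((n + 1) * T / hh P)) + 1 ≤ M * max 1 (1 / (E * hh P)) := by
    have e : 1 / (E * hh P) = t / hh P := by rw [ht]; field_simp
    rw [e]
    have h1 : (1:ℝ) ≤ max 1 (t / hh P) := le_max_left _ _
    have h2 : t / hh P ≤ max 1 (t / hh P) := le_max_right _ _
    calc _ ≤ 2 * (2 ^ n * (K * t / hh P)) + 1 := by gcongr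
      _ = 2 ^ (n + 1) * K * (t / hh P) + 1 := by rw [pow_succ]; ring
      _ ≤ 2 ^ (n + 1) * K * max 1 (t / hh P) + max 1 (t / hh P) := by gcongr
      _ = _ := by rw [hM]; ring
  set mx : ℝ := max 1 (1 / (E * hh P)) with hmx
  have hmx1 : 1 ≤ mx := le_max_left _ _
  have hd : k + 1 - P.natDegree ≤ n + 1 := by omega
  have hT0 : (0:ℝ) ≤ T := by positivity
  have main : (t / (16 * K)) ^ (k + 1) ≤ (M * mx) ^ (k + 1 - P.natDegree) *
      ((11 * K ^ 2 * (t * E1)) * (5 * K ^ 2 * (t * E1 + U / E1))) := by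
    calc (t / (16 * K)) ^ (k + 1) ≤ (T : ℝ) ^ (k + 1) := by gcongr
      _ ≤ _ := hcore
      _ ≤ _ := by
        have : 0 ≤ E + n * B ^ n * E1 := by positivity
        have : 0 ≤ hh P := by linarith
        gcongr
  have e1 : (11 * K ^ 2 * (t * E1)) * (5 * K ^ 2 * (t * E1 + U / E1)) =
      55 * K ^ 4 * (t * (U + E1 ^ 2 / E)) := by
    have : E1 ^ 2 / E = E1 ^ 2 * t := by rw [ht]; ring
    rw [this]; field_simp; ring
  rw [e1, div_pow, div_le_iff₀ (by positivity), mul_pow] at main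
  have m2 : t ^ k * t ≤ ((16 * K) ^ (n + 1) * (55 * K ^ 4) * M ^ (n + 1) * (U + E1 ^ 2 / E) *
      mx ^ (k + 1 - P.natDegree)) * t := by
    rw [← pow_succ]
    refine main.trans ?_
    have h1 : M ^ (k + 1 - P.natDegree) ≤ M ^ (n + 1) := pow_le_pow_right₀ hM1 hd
    have h2 : (16 * K) ^ (k + 1) ≤ (16 * K) ^ (n + 1) := pow_le_pow_right₀ (by linarith) (by omega)
    calc _ ≤ M ^ (n + 1) * mx ^ (k + 1 - P.natDegree) * (55 * K ^ 4 * (t * (U + E1 ^ 2 / E))) *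
          (16 * K) ^ (n + 1) := by gcongr
      _ = _ := by ring
  exact le_of_mul_le_mul_right m2 ht0

/-- version when the height is small -/
lemma ph_small (n : ℕ) (B : ℝ) (hB : 1 ≤ B) : ∃ C : ℝ, 1 ≤ C ∧ ∀ (x E E1 σ U : ℝ) (N k : ℕ)
    (p : ℕ → ℤ) (P : ℤ[X]), |x| ≤ B → k ≤ N → N ≤ n → |σ| ≤ E1 → |(p 0 : ℝ)| ≤ U →
    0 < E → E ≤ E1 → C * E ≤ 1 →
    (∀ i ≤ N, |(p i : ℝ) - x ^ i * p 0 - i * x ^ (i - 1) * σ| ≤ E) → P ≠ 0 →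
    1 ≤ P.natDegree → P.natDegree ≤ k + 1 →
    (∀ D : ℤ[X], D ≠ 0 → D.natDegree ≤ k → Kill p N D → P ∣ D) →
    (1 / E) ^ k ≤ C * (U + E1 ^ 2 / E) ∨
    hh P ^ (k + 1 - P.natDegree) ≤ C * (U + E1 ^ 2 / E) * E ^ (P.natDegree - 1) ∧ E * hh P ≤ 1 := by
  obtain ⟨C, hC1, hC⟩ := ph_main n B hB
  refine ⟨C, hC1, ?_⟩
  intro x E E1 σ U N k p P hx hk hN hσ hU hE hEE hCE hp hP hr hrk hdiv
  have h := hC x E E1 σ U N k p P hx hk hN hσ hU hE hEE hCE hp hP hdiv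
  have hhP := one_le_hh hP
  have hU0 : 0 ≤ U := (abs_nonneg _).trans hU
  rcases le_or_gt 1 (E * hh P) with h1 | h1
  · left
    rw [max_eq_left (by rw [div_le_one (by linarith)]; exact h1), one_pow, mul_one] at h
    exact h
  · right
    refine ⟨?_, h1.le⟩
    have hpos : 0 < E * hh P := by positivity
    rw [max_eq_right (by rw [le_div_iff₀ hpos]; linarith)] at h
    obtain ⟨d, hd⟩ : ∃ d, d = k + 1 - P.natDegree := ⟨_, rfl⟩
    have hkd : k = d + (P.natDegree - 1) := by omega
    rw [← hd] at h ⊢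
    generalize P.natDegree - 1 = r at *
    rw [hkd, one_div, one_div, inv_pow, inv_pow, mul_pow, ← div_eq_mul_inv,
      le_div_iff₀ (by positivity), pow_add, inv_mul_eq_div, div_le_iff₀ (by positivity)] at h
    have hEd : 0 < E ^ d := by positivity
    refine le_of_mul_le_mul_left ?_ hEd
    linarith

lemma ph_le (n : ℕ) (B : ℝ) (hB : 1 ≤ B) : ∃ C : ℝ, 1 ≤ C ∧ ∀ (x E E1 σ U : ℝ) (N k : ℕ)
    (p : ℕ → ℤ) (P : ℤ[X]), |x| ≤ B → k ≤ N → N ≤ n → |σ| ≤ E1 → |(p 0 : ℝ)| ≤ U →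
    0 < E → E ≤ E1 → C * E ≤ 1 →
    (∀ i ≤ N, |(p i : ℝ) - x ^ i * p 0 - i * x ^ (i - 1) * σ| ≤ E) → P ≠ 0 →
    1 ≤ P.natDegree → P.natDegree ≤ k + 1 → E * hh P ≤ 1 →
    (∀ D : ℤ[X], D ≠ 0 → D.natDegree ≤ k → Kill p N D → P ∣ D) →
    hh P ^ (k + 1 - P.natDegree) ≤ C * (U + E1 ^ 2 / E) * E ^ (P.natDegree - 1) := by
  obtain ⟨C, hC1, hC⟩ := ph_small n B hB
  refine ⟨C, hC1, ?_⟩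
  intro x E E1 σ U N k p P hx hk hN hσ hU hE hEE hCE hp hP hr hrk hEh hdiv
  rcases hC x E E1 σ U N k p P hx hk hN hσ hU hE hEE hCE hp hP hr hrk hdiv with h | h
  swap
  · exact h.1
  have hhP := one_le_hh hP
  have h1 : hh P ≤ 1 / E := by rw [le_div_iff₀ hE]; linarith
  obtain ⟨d, hd⟩ : ∃ d, d = k + 1 - P.natDegree := ⟨_, rfl⟩
  have hkd : k = d + (P.natDegree - 1) := by omega
  rw [← hd]
  generalize P.natDegree - 1 = r at *
  rw [hkd, pow_add] at h
  calc hh P ^ d ≤ (1 / E) ^ d := by gcongr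
    _ = (1 / E) ^ d * (1 / E) ^ r * E ^ r := by rw [mul_assoc, ← mul_pow]; field_simp; simp
    _ ≤ _ := by gcongr

end
end SimDioph

namespace SimDioph
open Polynomial

noncomputable section

lemma coprime_deriv {f : ℤ[X]} (hf : Irreducible f) (hd : f.natDegree ≠ 0) :
    IsCoprime (f.map (Int.castRingHom ℂ)) (derivative (f.map (Int.castRingHom ℂ))) := by
  have h1 : Irreducible (f.map (Int.castRingHom ℚ)) :=
    (IsPrimitive.Int.irreducible_iff_irreducible_map_cast (hf.isPrimitive hd)).1 hf
  have h2 := h1.separable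
  have h3 : ((f.map (Int.castRingHom ℚ)).map (algebraMap ℚ ℂ)).Separable := h2.map
  rw [Polynomial.map_map] at h3
  have e : (algebraMap ℚ ℂ).comp (Int.castRingHom ℚ) = Int.castRingHom ℂ := RingHom.ext_int _ _
  rw [e] at h3
  exact h3

lemma natDegree_deriv' (g : ℂ[X]) : (derivative g).natDegree = g.natDegree - 1 := by
  by_cases h : g.natDegree = 0
  · have := natDegree_derivative_le g
    omega
  · have := degree_derivative (p := g) h
    exact natDegree_eq_of_degree_eq_some this

lemma resultant_bound (g : ℂ[X]) (e : ℕ) (he : g.natDegree = e) (h : ℝ) (hg : g.mahlerMeasure ≤ h) :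
    ‖resultant g (derivative g) e (e - 1)‖ ≤
      (e + (e - 1)).factorial * ((e + 1) * 2 ^ e * h) ^ (e + (e - 1)) := by
  have hM := mahlerMeasure_nonneg g
  have hc : ∀ i, ‖g.coeff i‖ ≤ 2 ^ e * h := by
    intro i
    refine (norm_coeff_le_choose_mul_mahlerMeasure i g).trans ?_
    rw [he]
    have : ((e.choose i : ℕ) : ℝ) ≤ 2 ^ e := by exact_mod_cast Nat.choose_le_two_pow _ _
    gcongr
  have h0 : 0 ≤ 2 ^ e * h := (norm_nonneg _).trans (hc 0)
  have hX : 0 ≤ (e + 1) * 2 ^ e * h := by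
    rw [mul_assoc]; positivity
  have hc1 : ∀ i, ‖g.coeff i‖ ≤ (e + 1) * 2 ^ e * h := by
    intro i
    refine (hc i).trans ?_
    rw [mul_assoc]
    have : (1 : ℝ) ≤ e + 1 := by linarith [Nat.cast_nonneg (α := ℝ) e]
    nlinarith
  have hc2 : ∀ i, ‖(derivative g).coeff i‖ ≤ (e + 1) * 2 ^ e * h := by
    intro i
    by_cases hi : i ≤ e
    · rw [coeff_derivative, norm_mul, mul_comm, mul_assoc]
      have h1 : ‖((i : ℂ) + 1)‖ ≤ e + 1 := by
        have : ((i : ℂ) + 1) = ((i + 1 : ℕ) : ℂ) := by push_cast; rfl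
        rw [this, Complex.norm_natCast]
        push_cast
        have : (i : ℝ) ≤ e := by exact_mod_cast hi
        linarith
      exact mul_le_mul h1 (hc _) (norm_nonneg _) (by positivity)
    · rw [coeff_eq_zero_of_natDegree_lt, norm_zero]
      · exact hX
      · rw [natDegree_deriv', he]; omega
  have := Matrix.det_le (A := sylvester g (derivative g) e (e - 1)) (abv := (NormedField.toAbsoluteValue ℂ))
    (x := (e + 1) * 2 ^ e * h) (by
      intro i j
      change ‖sylvester g (derivative g) e (e - 1) i j‖ ≤ _
      simp only [sylvester, Matrix.of_apply]
      refine Fin.addCases (fun j1 => ?_) (fun j1 => ?_) j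
      · simp only [Fin.addCases_left]
        split_ifs
        · exact hc2 _
        · simpa using hX
      · simp only [Fin.addCases_right]
        split_ifs
        · exact hc1 _
        · simpa using hX)
  rw [Fintype.card_fin, nsmul_eq_mul] at this
  exact this

lemma root_loc (d : ℕ) (hd : 1 ≤ d) : ∃ C : ℝ, 1 ≤ C ∧ ∀ (f : ℤ[X]), Irreducible f → f.natDegree = d →
    ∀ x : ℝ, ∃ α : ℂ, α ∈ (f.map (Int.castRingHom ℂ)).roots ∧
      ‖(x : ℂ) - α‖ ≤ C * hh f ^ (d - 1) * |aeval x f| := by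
  classical
  obtain ⟨e, rfl⟩ : ∃ e, d = e + 1 := ⟨d - 1, by omega⟩
  set A : ℝ := (e + (e - 1)).factorial * ((e + 1) * 2 ^ e) ^ (e + (e - 1)) with hA
  have hA1 : 1 ≤ A := by
    have h1 : (1 : ℝ) ≤ (e + (e - 1)).factorial := by exact_mod_cast Nat.one_le_iff_ne_zero.2 (Nat.factorial_ne_zero _)
    have h2 : (1 : ℝ) ≤ ((e + 1) * 2 ^ e) ^ (e + (e - 1)) := by
      apply one_le_pow₀
      have h3 : (1 : ℝ) ≤ e + 1 := by linarith [Nat.cast_nonneg (α := ℝ) e]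
      have h4 : (1 : ℝ) ≤ 2 ^ e := one_le_pow₀ (by norm_num)
      exact one_le_mul_of_one_le_of_one_le h3 h4
    exact one_le_mul_of_one_le_of_one_le h1 h2
  refine ⟨A * 2 ^ e, one_le_mul_of_one_le_of_one_le hA1 (one_le_pow₀ (by norm_num)), ?_⟩
  intro f hf hdeg x
  set F := f.map (Int.castRingHom ℂ) with hF
  have hFd : F.natDegree = e + 1 := by
    rw [hF, natDegree_map_eq_of_injective (RingHom.injective_int _), hdeg]
  have hF0 : F ≠ 0 := by rintro h; rw [h] at hFd; simp at hFd
  have hne : F.roots.toFinset.Nonempty := by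
    obtain ⟨z, hz⟩ := IsAlgClosed.exists_root F (by
      rw [degree_eq_natDegree hF0, hFd]; exact_mod_cast Nat.succ_ne_zero e)
    exact ⟨z, by rw [Multiset.mem_toFinset, mem_roots hF0]; exact hz⟩
  obtain ⟨α, hα, hmin⟩ := Finset.exists_min_image F.roots.toFinset (fun z => ‖(x : ℂ) - z‖) hne
  rw [Multiset.mem_toFinset] at hα
  refine ⟨α, hα, ?_⟩
  have hroot : F.IsRoot α := (mem_roots hF0).1 hα
  obtain ⟨g, hg⟩ := dvd_iff_isRoot.2 hroot
  have hg0 : g ≠ 0 := by rintro rfl; simp at hg; exact hF0 hg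
  have hge : g.natDegree = e := by
    rw [hg, natDegree_mul (X_sub_C_ne_zero α) hg0, natDegree_X_sub_C] at hFd
    omega
  have hh1 : 1 ≤ hh f := one_le_hh hf.ne_zero
  have hMg : g.mahlerMeasure ≤ hh f := by
    have h1 : hh f = (X - C α).mahlerMeasure * g.mahlerMeasure := by
      rw [← mahlerMeasure_mul, ← hg, hh]
    rw [h1, mahlerMeasure_X_sub_C]
    have := mahlerMeasure_nonneg g
    nlinarith [le_max_left 1 ‖α‖]
  -- derivative
  have hder : derivative F = (X - C α) * derivative g + g * 1 := by
    rw [hg, derivative_mul, derivative_X_sub_C]; ring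
  have hevd : (derivative F).eval α = g.eval α := by rw [hder]; simp
  -- integrality of the resultant
  have hres1 : 1 ≤ ‖resultant F (derivative F) (e + 1) e‖ := by
    have h1 := resultant_ne_zero _ _ (coprime_deriv hf (by omega))
    rw [← hF, natDegree_deriv', hFd, Nat.add_sub_cancel] at h1
    have h2 : resultant F (derivative F) (e + 1) e =
        ((resultant f (derivative f) (e + 1) e : ℤ) : ℂ) := by
      rw [hF, derivative_map, resultant_map_map]; rfl
    rw [h2] at h1 ⊢
    rw [Complex.norm_intCast]
    have h3 : resultant f (derivative f) (e + 1) e ≠ 0 := by exact_mod_cast h1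
    exact_mod_cast Int.one_le_abs h3
  have hres2 : resultant F (derivative F) (e + 1) e =
      g.eval α * resultant g (derivative F) e e := by
    have h1 := resultant_mul_left (X - C α) g (derivative F) e (by rw [natDegree_deriv', hFd]; omega)
    rw [← hg, natDegree_X_sub_C, hge, resultant_X_sub_C_left _ _ _ (by rw [natDegree_deriv', hFd]; omega),
      hevd, add_comm 1 e] at h1
    exact h1
  have hres3 : ‖resultant g (derivative F) e e‖ = 1 ∧ e = 0 ∨ ‖resultant g (derivative F) e e‖
      = ‖g.eval α‖ * ‖resultant g (derivative g) e (e - 1)‖ := by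
    by_cases h0 : e = 0
    · left
      subst h0
      simp
    · right
      rw [hder, resultant_add_mul_right _ _ _ _ _ (by simp) hge.le]
      have h1 := resultant_mul_right g (X - C α) (derivative g) e hge.le
      rw [natDegree_X_sub_C, natDegree_deriv', hge, resultant_X_sub_C_right _ _ _ hge.le,
        show 1 + (e - 1) = e by omega] at h1
      rw [h1, norm_mul, norm_mul]
      simp
  have hlow : 1 ≤ ‖g.eval α‖ * (A * hh f ^ e) := by
    have hpe : 1 ≤ hh f ^ e := one_le_pow₀ hh1
    have hAe : 1 ≤ A * hh f ^ e := one_le_mul_of_one_le_of_one_le hA1 hpe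
    rw [hres2, norm_mul] at hres1
    have hga := norm_nonneg (g.eval α)
    rcases hres3 with ⟨h1, _⟩ | h1
    · rw [h1, mul_one] at hres1
      exact one_le_mul_of_one_le_of_one_le hres1 hAe
    · rw [h1] at hres1
      have hb := resultant_bound g e hge _ hMg
      have hb2 : ‖resultant g (derivative g) e (e - 1)‖ ≤ A * (hh f ^ e) ^ 2 := by
        refine hb.trans ?_
        rw [mul_pow, ← mul_assoc, ← hA, ← pow_mul]
        gcongr
        omega
      by_contra hcon
      push Not at hcon
      have h2 : ‖g.eval α‖ * (‖g.eval α‖ * ‖resultant g (derivative g) e (e - 1)‖) ≤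
        (‖g.eval α‖ * (A * hh f ^ e)) * (‖g.eval α‖ * (A * hh f ^ e)) := by
        calc _ ≤ ‖g.eval α‖ * (‖g.eval α‖ * (A * (hh f ^ e) ^ 2)) := by gcongr
          _ ≤ ‖g.eval α‖ * (‖g.eval α‖ * (A * (hh f ^ e) ^ 2)) * A := by
            apply le_mul_of_one_le_right (by positivity) hA1
          _ = _ := by ring
      have h3 : 0 ≤ ‖g.eval α‖ * (A * hh f ^ e) := by positivity
      nlinarith
  -- comparison of g(α) and g(x)
  have hcmp : ‖g.eval α‖ ≤ 2 ^ e * ‖g.eval (x : ℂ)‖ := by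
    have hsp : g.Splits := IsAlgClosed.splits g
    have hcard : g.roots.card = e := by rw [← hge]; exact hsp.natDegree_eq_card_roots.symm
    have hev : ∀ z : ℂ, ‖g.eval z‖ = ‖g.leadingCoeff‖ * (g.roots.map fun b => ‖z - b‖).prod := by
      intro z
      conv_lhs => rw [hsp.eq_prod_roots]
      rw [eval_mul, eval_C, norm_mul, eval_multiset_prod, Multiset.map_map]
      congr 1
      have := map_multiset_prod (normHom (α := ℂ)) (Multiset.map (eval z ∘ fun a => X - C a) g.roots)
      simp only [Multiset.map_map] at this
      simpa using this
    rw [hev, hev]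
    have hle : (g.roots.map fun b => ‖α - b‖).prod ≤ (g.roots.map fun b => 2 * ‖(x : ℂ) - b‖).prod := by
      apply Multiset.prod_map_le_prod_map₀
      · intro b _; positivity
      · intro b hb
        have hbF : b ∈ F.roots.toFinset := by
          rw [Multiset.mem_toFinset, mem_roots hF0, IsRoot, hg, eval_mul,
            (mem_roots hg0).1 hb, mul_zero]
        have h1 := hmin b hbF
        have h2 : α - b = ((x : ℂ) - b) - ((x : ℂ) - α) := by ring
        rw [h2]
        refine (norm_sub_le _ _).trans ?_
        linarith
    have e1 : (g.roots.map fun b => 2 * ‖(x : ℂ) - b‖).prod =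
        2 ^ e * (g.roots.map fun b => ‖(x : ℂ) - b‖).prod := by
      rw [Multiset.prod_map_mul]
      simp [hcard]
    rw [e1] at hle
    have := norm_nonneg g.leadingCoeff
    calc _ ≤ ‖g.leadingCoeff‖ * (2 ^ e * (g.roots.map fun b => ‖(x : ℂ) - b‖).prod) := by gcongr
      _ = _ := by ring
  have hfx : ‖F.eval (x : ℂ)‖ = |aeval x f| := by
    have : F.eval (x : ℂ) = ((aeval x f : ℝ) : ℂ) := by
      rw [hF, eval_map, aeval_def]
      have h1 := Polynomial.hom_eval₂ f (algebraMap ℤ ℝ) Complex.ofRealHom x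
      have h2 : Complex.ofRealHom.comp (algebraMap ℤ ℝ) = Int.castRingHom ℂ := RingHom.ext_int _ _
      rw [h2] at h1
      exact h1.symm
    rw [this, Complex.norm_real, Real.norm_eq_abs]
  have hfx2 : |aeval x f| = ‖(x : ℂ) - α‖ * ‖g.eval (x : ℂ)‖ := by
    rw [← hfx, hg, eval_mul, norm_mul]; simp
  rw [Nat.add_sub_cancel]
  calc ‖(x : ℂ) - α‖ = ‖(x : ℂ) - α‖ * 1 := by ring
    _ ≤ ‖(x : ℂ) - α‖ * (‖g.eval α‖ * (A * hh f ^ e)) := by gcongr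
    _ ≤ ‖(x : ℂ) - α‖ * ((2 ^ e * ‖g.eval (x : ℂ)‖) * (A * hh f ^ e)) := by gcongr
    _ = A * 2 ^ e * hh f ^ e * |aeval x f| := by rw [hfx2]; ring

end
end SimDioph

namespace SimDioph
open Polynomial

noncomputable section

lemma root_loc_unif (n : ℕ) : ∃ C : ℝ, 1 ≤ C ∧ ∀ (f : ℤ[X]), Irreducible f → 1 ≤ f.natDegree →
    f.natDegree ≤ n → ∀ x : ℝ, ∃ α : ℂ, α ∈ (f.map (Int.castRingHom ℂ)).roots ∧
      ‖(x : ℂ) - α‖ ≤ C * hh f ^ (f.natDegree - 1) * |aeval x f| := by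
  have h : ∀ d : ℕ, ∃ C : ℝ, 1 ≤ C ∧ (1 ≤ d → ∀ (f : ℤ[X]), Irreducible f → f.natDegree = d →
    ∀ x : ℝ, ∃ α : ℂ, α ∈ (f.map (Int.castRingHom ℂ)).roots ∧
      ‖(x : ℂ) - α‖ ≤ C * hh f ^ (d - 1) * |aeval x f|) := by
    intro d
    by_cases hd : 1 ≤ d
    · obtain ⟨C, h1, h2⟩ := root_loc d hd
      exact ⟨C, h1, fun _ => h2⟩
    · exact ⟨1, le_rfl, fun h => absurd h hd⟩
  choose C hC1 hC using h
  have hle : ∀ d ≤ n, C d ≤ ∑ i ∈ Finset.range (n + 1), C i := fun d hd =>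
    Finset.single_le_sum (f := C) (fun i _ => zero_le_one.trans (hC1 i)) (Finset.mem_range.2 (by omega))
  refine ⟨∑ i ∈ Finset.range (n + 1), C i, (hC1 0).trans (hle 0 (Nat.zero_le _)), ?_⟩
  intro f hf h1 hn x
  obtain ⟨α, hα, hle2⟩ := hC f.natDegree h1 f hf rfl x
  refine ⟨α, hα, hle2.trans ?_⟩
  have := hle _ hn
  have := hh_nonneg f
  gcongr

lemma ell_approx0 {x B e : ℝ} {n N : ℕ} (hB : 1 ≤ B) (hx : |x| ≤ B)
    (hN : N ≤ n) (p : ℕ → ℤ)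
    (hp : ∀ i ≤ N, |(p i : ℝ) - x ^ i * p 0| ≤ e) (R : ℤ[X])
    (hR : R.natDegree ≤ N) (T : ℝ) (hT : ∀ i, |(R.coeff i : ℝ)| ≤ T) :
    |(ell p R : ℝ) - p 0 * aeval x R| ≤ (n + 1) * T * e := by
  have := ell_approx (σ := 0) (E1 := 0) (E := e) hB hx le_rfl hN p (by simp) (by simpa using hp) R
    (Nat.lt_succ_of_le hR) hT
  simpa using this

lemma cmp_approx {x B e : ℝ} {n : ℕ} (hB : 1 ≤ B) (hx : |x| ≤ B) (p : ℕ → ℤ)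
    (hp : ∀ i ≤ n, |(p i : ℝ) - x ^ i * p 0| ≤ e) (G : ℤ[X]) (i : ℕ) (hi : i + G.natDegree ≤ n) :
    |((cmp p G i : ℤ) : ℝ) - x ^ i * ((cmp p G 0 : ℤ) : ℝ)| ≤ 2 ^ (n + 1) * (n + 1) * B ^ n * hh G * e := by
  have hT : ∀ i, |(G.coeff i : ℝ)| ≤ 2 ^ n * hh G := coeff_le_hh G n (by omega)
  have he : 0 ≤ e := (abs_nonneg _).trans (hp 0 (Nat.zero_le _))
  have hW : 1 ≤ B ^ n := one_le_pow₀ hB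
  have hG := hh_nonneg G
  have h1 := ell_approx0 hB hx le_rfl p hp G (by omega) _ hT
  have h2 := ell_approx0 hB hx le_rfl p hp (X ^ i * G)
    ((natDegree_mul_le).trans (by rw [natDegree_X_pow]; exact hi)) (2 ^ n * hh G) (by
      intro l
      rw [coeff_X_pow_mul']
      split_ifs
      · exact hT _
      · simp; positivity)
  have h3 := pow_abs_le (n := n) (i := i) hB hx (by omega)
  have e1 : ((cmp p G i : ℤ) : ℝ) - x ^ i * ((cmp p G 0 : ℤ) : ℝ) =
      ((ell p (X ^ i * G) : ℝ) - p 0 * aeval x (X ^ i * G)) - x ^ i * ((ell p G : ℝ) - p 0 * aeval x G) := by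
    simp only [cmp, pow_zero, one_mul, map_mul, map_pow, aeval_X]
    ring
  rw [e1]
  refine (abs_sub _ _).trans ?_
  rw [abs_mul]
  have h4 := mul_le_mul h3 h1 (abs_nonneg _) (by linarith)
  have h5 : 0 ≤ (n + 1) * (2 ^ n * hh G) * e := by positivity
  rw [pow_succ]
  nlinarith

lemma exists_min_small (m n : ℕ) (hn1 : 2 * m + 1 ≤ n) (hn2 : n ≤ 2 * m + 2) (B : ℝ) (hB : 1 ≤ B) :
    ∃ C δ : ℝ, 1 ≤ C ∧ 0 < δ ∧ δ ≤ 1 ∧ ∀ (H e x : ℝ) (p : ℕ → ℤ), 1 ≤ H → 0 < e → e * H ^ 2 ≤ δ →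
      |x| ≤ B → p 0 ≠ 0 → |(p 0 : ℝ)| ≤ 2 * H ^ n → (∀ i ≤ n, |(p i : ℝ) - x ^ i * p 0| ≤ e) →
      ∃ P, IsMin p n P ∧ 1 ≤ P.natDegree ∧ P.natDegree ≤ m + 1 ∧ hh P ≤ C * H := by
  obtain ⟨C1, hC1, hph1⟩ := ph_main n B hB
  obtain ⟨C2, hC2, hph2⟩ := ph_small n B hB
  refine ⟨3 * C2, 1 / (4 * C1 * C2), by linarith, by positivity, ?_, ?_⟩
  · rw [div_le_one (by positivity)]; nlinarith
  intro H e x p hH he heH hx hp0 hpH hp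
  set δ := 1 / (4 * C1 * C2) with hδ
  have hδ1 : 4 * C1 * δ ≤ 1 := by
    have : 4 * C1 * δ = 1 / C2 := by rw [hδ]; field_simp
    rw [this, div_le_one (by linarith)]; exact hC2
  have hδ2 : 4 * C2 * δ ≤ 1 := by
    have : 4 * C2 * δ = 1 / C1 := by rw [hδ]; field_simp
    rw [this, div_le_one (by linarith)]; exact hC1
  have hδ0 : 0 < δ := by positivity
  have hH2 : 1 ≤ H ^ 2 := one_le_pow₀ hH
  have heδ : e ≤ δ := by nlinarith
  have he1 : e ≤ 1 := by nlinarith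
  have hHn : 1 ≤ H ^ n := one_le_pow₀ hH
  have hW : 2 * H ^ n + e ^ 2 / e ≤ 3 * H ^ n := by
    have : e ^ 2 / e = e := by field_simp
    rw [this]; linarith
  -- the contradiction
  have hcontra : ∀ (C : ℝ) (k : ℕ), 1 ≤ C → 4 * C * δ ≤ 1 → m + 1 ≤ k →
      ¬ ((1 / e) ^ k ≤ C * (2 * H ^ n + e ^ 2 / e)) := by
    intro C k hC hCδ hk hle
    have h1 : (1 / e) ^ (m + 1) ≤ (1 / e) ^ k :=
      pow_le_pow_right₀ (by rw [le_div_iff₀ he]; linarith) hk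
    have h2 : H ^ 2 / δ ≤ 1 / e := by
      rw [div_le_div_iff₀ hδ0 he]; linarith
    have h3 : (H ^ 2 / δ) ^ (m + 1) ≤ (1 / e) ^ (m + 1) := by gcongr
    have hδ' : δ ≤ 1 := by nlinarith
    have h4 : H ^ n / δ ≤ (H ^ 2 / δ) ^ (m + 1) := by
      rw [div_pow, ← pow_mul]
      have : δ ^ (m + 1) ≤ δ := pow_le_of_le_one hδ0.le hδ' (by omega)
      have : H ^ n ≤ H ^ (2 * (m + 1)) := pow_le_pow_right₀ hH (by omega)
      gcongr
    have h5 : H ^ n / δ ≤ C * (3 * H ^ n) :=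
      (h4.trans (h3.trans (h1.trans hle))).trans (by gcongr)
    rw [div_le_iff₀ hδ0] at h5
    nlinarith
  obtain ⟨P, hP⟩ := exists_isMin p n
  have hP0 := hP.1.ne_zero
  have hp' : ∀ i ≤ n, |(p i : ℝ) - x ^ i * p 0 - i * x ^ (i - 1) * 0| ≤ e := by simpa using hp
  have hr1 : 1 ≤ P.natDegree := by
    by_contra h0
    have h0 : P.natDegree = 0 := by omega
    have hk := hP.2.1 0 (by omega)
    rw [eq_C_of_natDegree_eq_zero h0] at hk hP0
    have hc : P.coeff 0 ≠ 0 := by intro h; rw [h] at hP0; simp at hP0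
    rw [pow_zero, one_mul, ← monomial_zero_left, ell_monomial] at hk
    exact (mul_ne_zero hp0 hc) hk
  have hr2 : P.natDegree ≤ m + 1 := by
    by_contra hlt
    have h := hph1 x e e 0 (2 * H ^ n) n (m + 1) p P hx (by omega) le_rfl (by simpa using he.le) hpH he
      le_rfl (by nlinarith) hp' hP0 (by
        intro D hD hDk hk
        have := hP.2.2 D hD hk
        omega)
    rw [show m + 1 + 1 - P.natDegree = 0 by omega, pow_zero, mul_one] at h
    exact hcontra C1 (m + 1) hC1 hδ1 le_rfl h
  refine ⟨P, hP, hr1, hr2, ?_⟩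
  have hhP := one_le_hh hP0
  rcases hph2 x e e 0 (2 * H ^ n) n (n + 1 - P.natDegree) p P hx (by omega) le_rfl
      (by simpa using he.le) hpH he le_rfl (by nlinarith) hp' hP0 hr1 (by omega) (by
        intro D hD hDk hk
        exact hP.dvd hk (by omega)) with h | ⟨h, _⟩
  · exact absurd h (hcontra C2 _ hC2 hδ2 (by omega))
  · obtain ⟨r, hr⟩ : ∃ r, P.natDegree = r + 1 := ⟨P.natDegree - 1, by omega⟩
    obtain ⟨t, ht⟩ : ∃ t, n = 2 * r + t := ⟨n - 2 * r, by omega⟩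
    rw [show n + 1 - P.natDegree + 1 - P.natDegree = t by omega,
      show P.natDegree - 1 = r by omega] at h
    have ht0 : t ≠ 0 := by omega
    have h2 : hh P ^ t ≤ (3 * C2 * H) ^ t := by
      calc hh P ^ t ≤ C2 * (2 * H ^ n + e ^ 2 / e) * e ^ r := h
        _ ≤ C2 * (3 * H ^ n) * e ^ r := by gcongr
        _ = 3 * C2 * ((e * H ^ 2) ^ r * H ^ t) := by
            have hs : H ^ n = (H ^ 2) ^ r * H ^ t := by rw [← pow_mul, ← pow_add, ← ht]
            rw [hs, mul_pow]; ring
        _ ≤ 3 * C2 * (1 * H ^ t) := by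
            have : (e * H ^ 2) ^ r ≤ 1 := pow_le_one₀ (by positivity) (by nlinarith)
            gcongr
        _ ≤ (3 * C2) ^ t * H ^ t := by
            rw [one_mul]
            have : 3 * C2 ≤ (3 * C2) ^ t := le_self_pow₀ (by linarith) ht0
            gcongr
        _ = _ := by rw [mul_pow (3 * C2) H]
    exact le_of_pow_le_pow_left₀ ht0 (by positivity) h2

end
end SimDioph

namespace SimDioph
open Polynomial

noncomputable section

/-- The data attached to a point `x`. -/
structure Dat (m n : ℕ) (C H e x : ℝ) (f : ℤ[X]) (α : ℂ) (p : ℕ → ℤ) (g : ℝ) (j : ℕ) : Prop where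
  irr : Irreducible f
  one_le_d : 1 ≤ f.natDegree
  dj : f.natDegree + j ≤ m + 1
  root : α ∈ (f.map (Int.castRingHom ℂ)).roots
  one_le_g : 1 ≤ g
  approx : ∀ i ≤ n - j, |(p i : ℝ) - x ^ i * p 0| ≤ C * g * e
  one_le_U : 1 ≤ |(p 0 : ℝ)|
  near : ‖(x : ℂ) - α‖ ≤ C * hh f ^ f.natDegree * g * e / |(p 0 : ℝ)|
  kill : Kill p (n - j) f
  hg : hh f * g ≤ C * H
  bF : |(p 0 : ℝ)| * g ^ (n + 1 - f.natDegree - 2 * j) ≤ C * H ^ n * (hh f * e) ^ j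
  bG : hh f ^ (n + 2 - 2 * f.natDegree - j) ≤ C * |(p 0 : ℝ)| * (g * e) ^ (f.natDegree - 1)

lemma exists_irr_factor {P : ℤ[X]} (hP : P.IsPrimitive) (hd : 1 ≤ P.natDegree) :
    ∃ f G : ℤ[X], P = f * G ∧ Irreducible f ∧ 1 ≤ f.natDegree := by
  have hu : ¬ IsUnit P := by
    intro h
    have := natDegree_eq_zero_of_isUnit h
    omega
  obtain ⟨f, hf, G, hG⟩ := WfDvdMonoid.exists_irreducible_factor hu hP.ne_zero
  refine ⟨f, G, hG, hf, ?_⟩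
  by_contra h0
  have h0 : f.natDegree = 0 := by omega
  have hc := eq_C_of_natDegree_eq_zero h0
  have hun := hP (f.coeff 0) (by rw [← hc]; exact ⟨G, hG⟩)
  apply hf.not_isUnit
  rw [hc]
  exact hun.map C

set_option maxHeartbeats 2000000 in
lemma perx (m n : ℕ) (hn1 : 2 * m + 1 ≤ n) (hn2 : n ≤ 2 * m + 2) (B : ℝ) (hB : 1 ≤ B) :
    ∃ C δ : ℝ, 1 ≤ C ∧ 0 < δ ∧ δ ≤ 1 ∧ ∀ (H e x : ℝ) (p : ℕ → ℤ), 1 ≤ H → 0 < e → e * H ^ 2 ≤ δ →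
      |x| ≤ B → p 0 ≠ 0 → |(p 0 : ℝ)| ≤ 2 * H ^ n → (∀ i ≤ n, |(p i : ℝ) - x ^ i * p 0| ≤ e) →
      ∃ f α p1 g j, Dat m n C H e x f α p1 g j := by
  obtain ⟨C2, δ2, hC2, hδ2, hδ21, hmin⟩ := exists_min_small m n hn1 hn2 B hB
  obtain ⟨C3, hC3, hroot⟩ := root_loc_unif n
  obtain ⟨C4, hC4, hph⟩ := ph_le n B hB
  set A : ℝ := 2 ^ (n + 1) * (n + 1) * B ^ n with hA
  have hBn : 1 ≤ B ^ n := one_le_pow₀ hB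
  have h2n : (1 : ℝ) ≤ 2 ^ n := one_le_pow₀ (by norm_num)
  have hn0 : (1 : ℝ) ≤ n + 1 := by
    have : (0 : ℝ) ≤ n := Nat.cast_nonneg n
    linarith
  have hA' : (n + 1) * (2 ^ n * B ^ n) * 2 = A := by rw [hA]; ring
  have hA'' : ((n : ℝ) + 1) * 2 ^ n ≤ A := by
    have : ((n : ℝ) + 1) * 2 ^ n * 1 ≤ (n + 1) * 2 ^ n * B ^ n := by gcongr
    nlinarith [mul_nonneg (by linarith : (0:ℝ) ≤ (n:ℝ)+1) (by positivity : (0:ℝ) ≤ (2:ℝ)^n * B^n)]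
  have hA1 : 1 ≤ A := by nlinarith
  set K : ℝ := 6 * C2 * C3 * C4 * A ^ (n + 2) with hK
  have hAp : ∀ i ≤ n + 2, A ^ i ≤ A ^ (n + 2) := fun i hi => pow_le_pow_right₀ hA1 hi
  have hAp1 : ∀ i, 1 ≤ A ^ i := fun i => one_le_pow₀ hA1
  have hKgen : ∀ (a b c : ℝ) (i : ℕ), a ≤ 6 → 0 ≤ a → 0 ≤ b → b ≤ C2 * C3 * C4 → i ≤ n + 2 →
      a * b * A ^ i ≤ K := by
    intro a b c i ha ha0 hb0 hb hi
    have := hAp i hi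
    have h1 := hAp1 i
    rw [hK, show 6 * C2 * C3 * C4 * A ^ (n + 2) = 6 * (C2 * C3 * C4) * A ^ (n + 2) by ring]
    gcongr
  have h23 : 1 ≤ C2 * C3 := one_le_mul_of_one_le_of_one_le hC2 hC3
  have h24 : 1 ≤ C2 * C4 := one_le_mul_of_one_le_of_one_le hC2 hC4
  have h34 : 1 ≤ C3 * C4 := one_le_mul_of_one_le_of_one_le hC3 hC4
  have h2le : C2 ≤ C2 * C3 * C4 := by nlinarith
  have h3le : C3 ≤ C2 * C3 * C4 := by nlinarith
  have h4le : C4 ≤ C2 * C3 * C4 := by nlinarith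
  have h1le : 1 ≤ C2 * C3 * C4 := hC2.trans h2le
  have hK1 : 1 ≤ K := by simpa using hKgen 1 1 1 0 (by norm_num) (by norm_num) (by norm_num) h1le (by omega)
  refine ⟨K, min δ2 (1 / (2 * A * C2 * C4)), hK1, by positivity, (min_le_left _ _).trans hδ21, ?_⟩
  intro H e x p hH he heH hx hp0 hpH hp
  obtain ⟨P, hP, hr1, hr2, hhP⟩ := hmin H e x p hH he (heH.trans (min_le_left _ _)) hx hp0 hpH hp
  have heH2 := heH.trans (min_le_right _ _)
  obtain ⟨f, G, rfl, hf, hd1⟩ := exists_irr_factor hP.1 hr1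
  have hf0 := hf.ne_zero
  have hG0 : G ≠ 0 := right_ne_zero_of_mul hP.1.ne_zero
  rw [natDegree_mul hf0 hG0] at hr1 hr2
  rw [hh_mul] at hhP
  have hg1 := one_le_hh hG0
  have hh1 := one_le_hh hf0
  set d := f.natDegree with hd
  set j := G.natDegree with hj
  set g := hh G with hg
  set h1 := hh f with hh1'
  set p1 := cmp p G with hp1
  have hHn : 1 ≤ H ^ n := one_le_pow₀ hH
  -- smallness
  have hsm : A * C4 * (h1 * g * e) ≤ 1 / 2 := by
    have e1 : h1 * g * e ≤ C2 * (e * H ^ 2) := by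
      have : h1 * g * e ≤ C2 * H * e := by gcongr
      have : C2 * H * e ≤ C2 * (e * H ^ 2) := by
        have h : H ≤ H ^ 2 := le_self_pow₀ hH (by norm_num)
        have : C2 * e * H ≤ C2 * e * H ^ 2 := by gcongr
        linarith
      linarith
    have e2 : A * C4 * (h1 * g * e) ≤ A * C4 * (C2 * (1 / (2 * A * C2 * C4))) := by
      have : h1 * g * e ≤ C2 * (1 / (2 * A * C2 * C4)) := e1.trans (by gcongr)
      gcongr
    refine e2.trans (le_of_eq ?_)
    field_simp
  have hgle : g ≤ h1 * g := le_mul_of_one_le_left (by linarith) hh1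
  have hhle : h1 ≤ h1 * g := le_mul_of_one_le_right (by linarith) hg1
  have hE0 : 0 < A * g * e := by positivity
  have hE20 : 0 < A * h1 * e := by positivity
  have hbase : A * (h1 * g * e) ≤ 1 / 2 := by
    have : A * (h1 * g * e) * 1 ≤ A * (h1 * g * e) * C4 := by gcongr
    linarith
  have hE : A * g * e ≤ 1 / 2 := by
    have : A * e * g ≤ A * e * (h1 * g) := by gcongr
    linarith
  have hE2 : A * h1 * e ≤ 1 / 2 := by
    have : A * e * h1 ≤ A * e * (h1 * g) := by gcongr
    linarith
  have hE4 : C4 * (A * g * e) ≤ 1 := by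
    have : C4 * (A * e) * g ≤ C4 * (A * e) * (h1 * g) := by gcongr
    linarith
  have hE24 : C4 * (A * h1 * e) ≤ 1 := by
    have : C4 * (A * e) * h1 ≤ C4 * (A * e) * (h1 * g) := by gcongr
    linarith
  have happ1 : ∀ i ≤ n - j, |(p1 i : ℝ) - x ^ i * p1 0| ≤ A * g * e := fun i hi =>
    cmp_approx hB hx p hp G i (by omega)
  have happ2 : ∀ i ≤ n - d, |((cmp p f i : ℤ) : ℝ) - x ^ i * ((cmp p f 0 : ℤ) : ℝ)| ≤ A * h1 * e :=
    fun i hi => cmp_approx hB hx p hp f i (by omega)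
  have hmin1 : IsMin p1 (n - j) f := hP.factor (by omega)
  have hmin2 : IsMin (cmp p f) (n - d) G := by
    rw [mul_comm] at hP
    exact hP.factor (by omega)
  -- (B)
  have hp10 : p1 0 ≠ 0 := by
    intro h0
    have hz : ∀ i ≤ n - j, p1 i = 0 := by
      intro i hi
      have h := happ1 i hi
      rw [h0] at h
      simp only [Int.cast_zero, mul_zero, sub_zero] at h
      have h3 : |(p1 i : ℝ)| < 1 := by linarith
      have h4 : |p1 i| < 1 := by exact_mod_cast h3
      exact Int.abs_lt_one_iff.1 h4
    have hk : Kill p n G := by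
      intro i hi
      exact hz i (by omega)
    have := hP.2.2 G hG0 hk
    rw [natDegree_mul hf0 hG0] at this
    omega
  have hU1 : 1 ≤ |(p1 0 : ℝ)| := by exact_mod_cast Int.one_le_abs hp10
  set U := |(p1 0 : ℝ)| with hU
  have hU0 : 0 < U := by linarith
  -- value at f
  have hfx : |aeval x f| ≤ A ^ 2 * h1 * g * e / U := by
    have h := ell_approx0 (N := n - j) hB hx (Nat.sub_le _ _) p1 happ1 f (by omega) (2 ^ n * h1)
      (coeff_le_hh f n (by omega))
    have h0 : ell p1 f = 0 := by simpa using hmin1.2.1 0 (by omega)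
    rw [h0] at h
    simp only [Int.cast_zero, zero_sub, abs_neg, abs_mul] at h
    rw [le_div_iff₀ hU0]
    have : ((n : ℝ) + 1) * 2 ^ n * (h1 * (A * g * e)) ≤ A * (h1 * (A * g * e)) := by gcongr
    change U * _ ≤ _ at h
    calc |aeval x f| * U = U * |aeval x f| := mul_comm _ _
      _ ≤ (n + 1) * (2 ^ n * h1) * (A * g * e) := h
      _ = (n + 1) * 2 ^ n * (h1 * (A * g * e)) := by ring
      _ ≤ A * (h1 * (A * g * e)) := this
      _ = _ := by ring
  obtain ⟨α, hα, hαx⟩ := hroot f hf hd1 (by omega) x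
  -- upper bound of U
  have hUle : U ≤ 2 * A * g * H ^ n := by
    have h := ell_approx0 (N := n) hB hx le_rfl p hp G (by omega) (2 ^ n * g)
      (coeff_le_hh G n (by omega))
    have hGx := aeval_abs_le (k := n) hB hx le_rfl G (by omega) (coeff_le_hh G n (by omega))
    have h0 : p1 0 = ell p G := by simp [hp1, cmp]
    rw [← h0] at h
    have h2 : U ≤ |(p 0 : ℝ)| * |aeval x G| + (n + 1) * (2 ^ n * g) * e := by
      rw [← abs_mul]
      have := abs_sub_abs_le_abs_sub (p1 0 : ℝ) (p 0 * aeval x G)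
      linarith
    have h3 : |(p 0 : ℝ)| * |aeval x G| ≤ 2 * H ^ n * ((n + 1) * B ^ n * (2 ^ n * g)) := by gcongr
    have h4 : ((n : ℝ) + 1) * 2 ^ n * (g * e) ≤ A * (g * e) := by gcongr
    have h5 : A * g * 1 ≤ A * g * H ^ n := by gcongr
    have h6 : 2 * H ^ n * ((n + 1) * B ^ n * (2 ^ n * g)) = A * g * H ^ n := by rw [← hA']; ring
    have h7 : 1 ≤ A * g := one_le_mul_of_one_le_of_one_le hA1 hg1
    have h8 : ((n : ℝ) + 1) * (2 ^ n * g) * e = (n + 1) * 2 ^ n * (g * e) := by ring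
    linarith
  refine ⟨f, α, p1, g, j, hf, hd1, hr2, hα, hg1, ?_, hU1, ?_, hmin1.2.1, ?_, ?_, ?_⟩
  · intro i hi
    refine (happ1 i hi).trans ?_
    have : 1 * 1 * A ^ 1 ≤ K := hKgen 1 1 1 1 (by norm_num) (by norm_num) (by norm_num) h1le (by omega)
    rw [one_mul, one_mul, pow_one] at this
    gcongr
  · refine hαx.trans ?_
    have e1 : C3 * h1 ^ (d - 1) * |aeval x f| ≤ C3 * h1 ^ (d - 1) * (A ^ 2 * h1 * g * e / U) := by
      gcongr
    refine e1.trans ?_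
    have e2 : C3 * h1 ^ (d - 1) * (A ^ 2 * h1 * g * e / U) = 1 * C3 * A ^ 2 * h1 ^ d * g * e / U := by
      obtain ⟨d', hd'⟩ : ∃ d', d = d' + 1 := ⟨d - 1, by omega⟩
      rw [hd', Nat.add_sub_cancel, pow_succ]; ring
    rw [e2]
    have := hKgen 1 C3 1 2 (by norm_num) (by norm_num) (by linarith) h3le (by omega)
    gcongr
  · refine hhP.trans ?_
    have := hKgen 1 C2 1 0 (by norm_num) (by norm_num) (by linarith) h2le (by omega)
    rw [one_mul, pow_zero, mul_one] at this
    gcongr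
  · by_cases hj0 : j = 0
    · have hGu : IsUnit G := by
        have hc := eq_C_of_natDegree_eq_zero hj0
        have hpr : G.IsPrimitive := isPrimitive_of_mul (F := G) (G := f) (by rw [mul_comm]; exact hP.1)
        have hun := hpr (G.coeff 0) (by rw [← hc])
        rw [hc]
        exact hun.map C
      have hgu : g = 1 := hh_isUnit hGu
      rw [hj0, hgu, one_pow, mul_one, pow_zero, mul_one]
      rw [hgu, mul_one] at hUle
      refine hUle.trans ?_
      have := hKgen 2 1 1 1 (by norm_num) (by norm_num) (by norm_num) h1le (by omega)
      rw [mul_one, pow_one] at this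
      gcongr
    · obtain ⟨l, hl⟩ : ∃ l, j = l + 1 := ⟨j - 1, by omega⟩
      set t := n + 1 - d - 2 * j with ht
      have hp20 : |((cmp p f 0 : ℤ) : ℝ)| ≤ 2 * H ^ n * (A ^ 2 * h1 * g * e / U) + A * h1 * e := by
        have h := ell_approx0 (N := n) hB hx le_rfl p hp f (by omega) (2 ^ n * h1)
          (coeff_le_hh f n (by omega))
        have h0 : cmp p f 0 = ell p f := by simp [cmp]
        rw [← h0] at h
        have h2 := abs_sub_abs_le_abs_sub ((cmp p f 0 : ℤ) : ℝ) (p 0 * aeval x f)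
        rw [abs_mul] at h2
        have h3 : |(p 0 : ℝ)| * |aeval x f| ≤ 2 * H ^ n * (A ^ 2 * h1 * g * e / U) := by gcongr
        have h4 : ((n : ℝ) + 1) * 2 ^ n * (h1 * e) ≤ A * (h1 * e) := by gcongr
        have h8 : ((n : ℝ) + 1) * (2 ^ n * h1) * e = (n + 1) * 2 ^ n * (h1 * e) := by ring
        linarith
      have hE2g : A * h1 * e * g ≤ 1 := by linarith
      have h := hph x (A * h1 * e) (A * h1 * e) 0 _ (n - d) (n - d - j + 1) (cmp p f) G hx (by omega)
        (Nat.sub_le _ _) (by simpa using hE20.le) hp20 hE20 le_rfl hE24 (by simpa using happ2) hG0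
        (by omega) (by omega) hE2g (fun D hD hDk hk => hmin2.dvd hk (by omega))
      rw [show n - d - j + 1 + 1 - G.natDegree = t + 1 by omega, show G.natDegree - 1 = l by omega] at h
      have hW : 2 * H ^ n * (A ^ 2 * h1 * g * e / U) + A * h1 * e + (A * h1 * e) ^ 2 / (A * h1 * e) ≤
          6 * A ^ 2 * H ^ n * h1 * g * e / U := by
        have e1 : (A * h1 * e) ^ 2 / (A * h1 * e) = A * h1 * e := by field_simp
        have e2 : A * h1 * e ≤ 2 * A ^ 2 * g * H ^ n * h1 * e / U := by
          rw [le_div_iff₀ hU0]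
          have : A * h1 * e * U ≤ A * h1 * e * (2 * A * g * H ^ n) := by gcongr
          linarith
        rw [e1]
        have e3 : 6 * A ^ 2 * H ^ n * h1 * g * e / U = 2 * H ^ n * (A ^ 2 * h1 * g * e / U) +
          2 * (2 * A ^ 2 * g * H ^ n * h1 * e / U) := by ring
        rw [e3]; linarith
      have h2 : g ^ (t + 1) ≤ C4 * (6 * A ^ 2 * H ^ n * h1 * g * e / U) * (A * h1 * e) ^ l :=
        h.trans (by gcongr)
      have h3 : g ^ (t + 1) * U ≤ C4 * (6 * A ^ 2 * H ^ n * h1 * g * e) * (A * h1 * e) ^ l := by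
        calc g ^ (t + 1) * U ≤ C4 * (6 * A ^ 2 * H ^ n * h1 * g * e / U) * (A * h1 * e) ^ l * U := by
              gcongr
          _ = _ := by field_simp
      have h4 : g * (U * g ^ t) ≤ g * (6 * C4 * A ^ (l + 2) * H ^ n * (h1 * e) ^ j) := by
        calc g * (U * g ^ t) = g ^ (t + 1) * U := by ring
          _ ≤ _ := h3
          _ = _ := by rw [hl, mul_assoc A h1 e, mul_pow A (h1 * e)]; ring
      have h5 := le_of_mul_le_mul_left h4 (by linarith)
      refine h5.trans ?_
      have := hKgen 6 C4 1 (l + 2) (by norm_num) (by norm_num) (by linarith) h4le (by omega)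
      gcongr
  · have hEh : A * g * e * h1 ≤ 1 := by linarith
    have h := hph x (A * g * e) (A * g * e) 0 U (n - j) (n - d - j + 1) p1 f hx (by omega)
        (Nat.sub_le _ _) (by simpa using hE0.le) le_rfl hE0 le_rfl hE4 (by simpa using happ1) hf0
        (by omega) (by omega) hEh (fun D hD hDk hk => hmin1.dvd hk (by omega))
    rw [show n - d - j + 1 + 1 - f.natDegree = n + 2 - 2 * d - j by omega] at h
    refine h.trans ?_
    have e1 : (A * g * e) ^ 2 / (A * g * e) = A * g * e := by field_simp
    rw [e1]
    have e2 : U + A * g * e ≤ 2 * U := by linarith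
    calc C4 * (U + A * g * e) * (A * g * e) ^ (d - 1) ≤ C4 * (2 * U) * (A * g * e) ^ (d - 1) := by gcongr
      _ = 2 * C4 * A ^ (d - 1) * U * (g * e) ^ (d - 1) := by
          rw [mul_assoc A g e, mul_pow A (g * e)]; ring
      _ ≤ K * U * (g * e) ^ (d - 1) := by
          have := hKgen 2 C4 1 (d - 1) (by norm_num) (by norm_num) (by linarith) h4le (by omega)
          gcongr

end
end SimDioph

namespace SimDioph
open Polynomial

noncomputable section

lemma taylor2 {x y B : ℝ} (hB : 1 ≤ B) (hx : |x| ≤ B) (hy : |y| ≤ B) (i : ℕ) :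
    |y ^ i - x ^ i - i * x ^ (i - 1) * (y - x)| ≤ (i : ℝ) ^ 2 * B ^ i * (y - x) ^ 2 := by
  induction i with
  | zero => simp
  | succ i ih =>
    have hBi : 1 ≤ B ^ i := one_le_pow₀ hB
    have key : y ^ (i + 1) - x ^ (i + 1) - ((i + 1 : ℕ) : ℝ) * x ^ (i + 1 - 1) * (y - x) =
        y * (y ^ i - x ^ i - i * x ^ (i - 1) * (y - x)) + i * x ^ (i - 1) * (y - x) ^ 2 := by
      rcases i with _ | i
      · simp
      · simp only [Nat.add_sub_cancel]; push_cast; ring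
    rw [key]
    have h1 : |x ^ (i - 1)| ≤ B ^ i := pow_abs_le hB hx (by omega)
    have h2 : |y * (y ^ i - x ^ i - i * x ^ (i - 1) * (y - x))| ≤
        B * ((i : ℝ) ^ 2 * B ^ i * (y - x) ^ 2) := by
      rw [abs_mul]; gcongr
    have h3 : |(i : ℝ) * x ^ (i - 1) * (y - x) ^ 2| ≤ i * B ^ i * (y - x) ^ 2 := by
      rw [abs_mul, abs_mul, abs_of_nonneg (sq_nonneg (y - x)), Nat.abs_cast]; gcongr
    refine (abs_add_le _ _).trans ((add_le_add h2 h3).trans ?_)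
    have h4 : (i : ℝ) * B ^ i * (y - x) ^ 2 ≤ i * (B ^ i * B) * (y - x) ^ 2 := by
      have : B ^ i * 1 ≤ B ^ i * B := by gcongr
      rw [mul_one] at this
      gcongr
    have h5 : 0 ≤ ((i : ℝ) + 1) * (B ^ i * B) * (y - x) ^ 2 := by positivity
    push_cast
    rw [pow_succ B i]
    nlinarith

lemma ell_sub_fun (p q : ℕ → ℤ) (R : ℤ[X]) : ell (fun i => p i - q i) R = ell p R - ell q R := by
  rw [ell_sum_range _ R _ (Nat.lt_succ_self _), ell_sum_range _ R _ (Nat.lt_succ_self _),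
    ell_sum_range _ R _ (Nat.lt_succ_self _), ← Finset.sum_sub_distrib]
  exact Finset.sum_congr rfl fun i _ => by ring

set_option maxHeartbeats 2000000 in
lemma sep (m n : ℕ) (hn1 : 2 * m + 1 ≤ n) (B : ℝ) (hB : 1 ≤ B)
    (C : ℝ) (hC : 1 ≤ C) : ∃ C5 δ : ℝ, 1 ≤ C5 ∧ 0 < δ ∧ ∀ (H e x y : ℝ) (f : ℤ[X]) (α : ℂ)
      (p q : ℕ → ℤ) (g g' : ℝ) (j : ℕ) (γ u : ℝ), 1 ≤ H → 0 < e → e * H ^ 2 ≤ δ → |x| ≤ B → |y| ≤ B →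
      Dat m n C H e x f α p g j → Dat m n C H e y f α q g' j → 1 ≤ γ → γ ≤ g → g ≤ 2 * γ →
      g' ≤ 2 * γ → 1 ≤ u → u ≤ |(p 0 : ℝ)| → |(p 0 : ℝ)| ≤ 2 * u → u ≤ |(q 0 : ℝ)| →
      |(q 0 : ℝ)| ≤ 2 * u → (∃ i ≤ n - j, p i ≠ q i) →
      hh f ^ (n + 2 - 2 * f.natDegree - j) ≤
        C5 * |(p 0 : ℝ) - q 0| * (γ * e) ^ (f.natDegree - 1) := by
  obtain ⟨C4, hC4, hph⟩ := ph_le n B hB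
  have hBn : 1 ≤ B ^ n := one_le_pow₀ hB
  have hC0 : 0 < C := by linarith
  set M : ℝ := 8 * C + 2 * ((n : ℝ) ^ 2 * B ^ n) * (2 ^ (n + 4) * C ^ 3) with hM
  have hM8 : 8 * C ≤ M := by
    have : 0 ≤ 2 * ((n : ℝ) ^ 2 * B ^ n) * (2 ^ (n + 4) * C ^ 3) := by positivity
    linarith
  have hM1 : 1 ≤ M := by linarith
  have hMn : 1 ≤ M ^ n := one_le_pow₀ hM1
  refine ⟨2 * C4 * M ^ n, 1 / (2 * C4 * M * C ^ 2), ?_, by positivity, ?_⟩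
  · have : 1 ≤ C4 * M ^ n := one_le_mul_of_one_le_of_one_le hC4 hMn
    linarith
  intro H e x y f α p q g g' j γ u hH he heδ hx hy Dx Dy hγ hγg hg2 hg2' hu hup hpu huq hqu hne
  have hd1 := Dx.one_le_d
  have hdj := Dx.dj
  have hf0 := Dx.irr.ne_zero
  have hh1 := one_le_hh hf0
  have nearx := Dx.near
  have neary := Dy.near
  have bG := Dx.bG
  have hg := Dx.hg
  have apx := Dx.approx
  have apy := Dy.approx
  have h1g := Dx.one_le_g
  have hkx := Dx.kill
  have hky := Dy.kill
  set d := f.natDegree with hd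
  set h1 := hh f with hh1'
  set w := γ * e with hw
  have hw0 : 0 < w := by positivity
  have hu0 : 0 < u := by linarith
  -- smallness
  have hsm : C4 * M * (h1 ^ 2 * w) ≤ 1 / 2 := by
    have e1 : h1 ≤ C * H := le_trans (le_mul_of_one_le_right (by linarith) h1g) hg
    have e2 : h1 ^ 2 * w ≤ C ^ 2 * (e * H ^ 2) := by
      calc h1 ^ 2 * w ≤ h1 ^ 2 * (g * e) := by rw [hw]; gcongr
        _ = h1 * (h1 * g) * e := by ring
        _ ≤ (C * H) * (C * H) * e := by gcongr
        _ = _ := by ring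
    calc C4 * M * (h1 ^ 2 * w) ≤ C4 * M * (C ^ 2 * (1 / (2 * C4 * M * C ^ 2))) := by
          have : h1 ^ 2 * w ≤ C ^ 2 * (1 / (2 * C4 * M * C ^ 2)) := e2.trans (by gcongr)
          gcongr
      _ = 1 / 2 := by field_simp
  have hsm0 : 0 < h1 ^ 2 * w := by positivity
  have hCM : 1 ≤ C4 * M := one_le_mul_of_one_le_of_one_le hC4 hM1
  have hsm1 : M * (h1 ^ 2 * w) ≤ 1 / 2 := by
    have : M * (h1 ^ 2 * w) * 1 ≤ M * (h1 ^ 2 * w) * C4 := by gcongr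
    linarith
  have hsm2 : h1 ^ 2 * w ≤ 1 := by
    have : h1 ^ 2 * w * 1 ≤ h1 ^ 2 * w * M := by gcongr
    linarith
  have hh2 : 1 ≤ h1 ^ 2 := one_le_pow₀ hh1
  have hwle : w ≤ h1 ^ 2 * w := le_mul_of_one_le_left hw0.le hh2
  have hwle' : h1 * w ≤ h1 ^ 2 * w := by
    have : h1 ≤ h1 ^ 2 := le_self_pow₀ hh1 (by norm_num)
    gcongr
  -- distance
  have hdist : |y - x| ≤ 4 * C * h1 ^ d * w / u := by
    have aux : ∀ (t G V : ℝ), t ≤ C * h1 ^ d * G * e / V → G ≤ 2 * γ → u ≤ V →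
        t ≤ 2 * C * h1 ^ d * w / u := by
      intro t G V h1' h2' h3'
      refine h1'.trans ?_
      rw [hw]
      have : C * h1 ^ d * G * e / V ≤ C * h1 ^ d * (2 * γ) * e / u := by gcongr
      refine this.trans (le_of_eq (by ring))
    have h3 := aux _ _ _ nearx hg2 hup
    have h4 := aux _ _ _ neary hg2' huq
    have h5 : ‖((y - x : ℝ) : ℂ)‖ ≤ ‖(x : ℂ) - α‖ + ‖(y : ℂ) - α‖ := by
      rw [show ((y - x : ℝ) : ℂ) = ((y : ℂ) - α) - ((x : ℂ) - α) by push_cast; ring]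
      linarith [norm_sub_le ((y : ℂ) - α) ((x : ℂ) - α)]
    rw [Complex.norm_real, Real.norm_eq_abs] at h5
    have : 4 * C * h1 ^ d * w / u = 2 * C * h1 ^ d * w / u + 2 * C * h1 ^ d * w / u := by ring
    linarith
  -- from (G)
  have hGu : h1 ^ (2 * d) * w ≤ 2 ^ n * C * u := by
    have e0 : 1 ≤ h1 ^ (n + 2 - 2 * d - j) := one_le_pow₀ hh1
    have e1 : 1 ≤ C * (2 * u) * (2 * w) ^ (d - 1) := by
      refine e0.trans (bG.trans ?_)
      have : g * e ≤ 2 * w := by rw [hw, ← mul_assoc]; gcongr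
      gcongr
    have e2 : (h1 ^ 2 * w) ^ d ≤ 1 := pow_le_one₀ hsm0.le hsm2
    obtain ⟨d', hd'⟩ : ∃ d', d = d' + 1 := ⟨d - 1, by omega⟩
    rw [hd', Nat.add_sub_cancel] at e1
    calc h1 ^ (2 * d) * w = h1 ^ (2 * d) * w * 1 := by ring
      _ ≤ h1 ^ (2 * d) * w * (C * (2 * u) * (2 * w) ^ d') := by gcongr
      _ = 2 ^ d * C * u * (h1 ^ 2 * w) ^ d := by
          rw [hd', mul_pow 2 w, mul_pow (h1 ^ 2) w, ← pow_mul]; ring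
      _ ≤ 2 ^ d * C * u * 1 := by gcongr
      _ ≤ 2 ^ n * C * u := by
          have : (2 : ℝ) ^ d ≤ 2 ^ n := pow_le_pow_right₀ (by norm_num) (by omega)
          rw [mul_one]
          gcongr
  have hquad : u * (y - x) ^ 2 ≤ 2 ^ (n + 4) * C ^ 3 * w := by
    have e1 : (y - x) ^ 2 ≤ (4 * C * h1 ^ d * w / u) ^ 2 := by
      rw [← sq_abs]; gcongr
    calc u * (y - x) ^ 2 ≤ u * (4 * C * h1 ^ d * w / u) ^ 2 := by gcongr
      _ = 16 * C ^ 2 * w * (h1 ^ (2 * d) * w) / u := by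
          rw [mul_comm 2 d, pow_mul]; field_simp; ring
      _ ≤ 16 * C ^ 2 * w * (2 ^ n * C * u) / u := by gcongr
      _ = _ := by field_simp; ring
  set E : ℝ := M * w with hE
  have hE0 : 0 < E := by positivity
  set σ : ℝ := -((q 0 : ℝ) * (y - x)) with hσ
  have hσE : |σ| ≤ h1 ^ d * E := by
    rw [hσ, abs_neg, abs_mul]
    calc |(q 0 : ℝ)| * |y - x| ≤ (2 * u) * (4 * C * h1 ^ d * w / u) := by gcongr
      _ = 8 * C * (h1 ^ d * w) := by field_simp; ring
      _ ≤ M * (h1 ^ d * w) := by gcongr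
      _ = _ := by rw [hE]; ring
  have hEE1 : E ≤ h1 ^ d * E := le_mul_of_one_le_left hE0.le (one_le_pow₀ hh1)
  have herr : ∀ i ≤ n - j, |((p i - q i : ℤ) : ℝ) - x ^ i * ((p 0 - q 0 : ℤ) : ℝ) -
      i * x ^ (i - 1) * σ| ≤ E := by
    intro i hi
    have t1 := apx i hi
    have t2 := apy i hi
    have t3 := taylor2 hB hx hy i
    have eq : ((p i - q i : ℤ) : ℝ) - x ^ i * ((p 0 - q 0 : ℤ) : ℝ) - i * x ^ (i - 1) * σ =
        ((p i : ℝ) - x ^ i * p 0) - ((q i : ℝ) - y ^ i * q 0) -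
          q 0 * (y ^ i - x ^ i - i * x ^ (i - 1) * (y - x)) := by
      rw [hσ]; push_cast; ring
    rw [eq]
    have t4 : |(q 0 : ℝ) * (y ^ i - x ^ i - i * x ^ (i - 1) * (y - x))| ≤
        2 * ((n : ℝ) ^ 2 * B ^ n) * (2 ^ (n + 4) * C ^ 3) * w := by
      rw [abs_mul]
      have hin : i ≤ n := hi.trans (Nat.sub_le _ _)
      calc _ ≤ (2 * u) * ((i : ℝ) ^ 2 * B ^ i * (y - x) ^ 2) := by gcongr
        _ ≤ (2 * u) * ((n : ℝ) ^ 2 * B ^ n * (y - x) ^ 2) := by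
            have : (i : ℝ) ≤ n := by exact_mod_cast hin
            gcongr
        _ = 2 * ((n : ℝ) ^ 2 * B ^ n) * (u * (y - x) ^ 2) := by ring
        _ ≤ 2 * ((n : ℝ) ^ 2 * B ^ n) * (2 ^ (n + 4) * C ^ 3 * w) := by gcongr
        _ = _ := by ring
    have t5 : C * g * e ≤ 2 * C * w := by
      calc C * g * e ≤ C * (2 * γ) * e := by gcongr
        _ = _ := by rw [hw]; ring
    have t6 : C * g' * e ≤ 2 * C * w := by
      calc C * g' * e ≤ C * (2 * γ) * e := by gcongr
        _ = _ := by rw [hw]; ring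
    refine (abs_sub _ _).trans ?_
    have t7 := abs_sub ((p i : ℝ) - x ^ i * p 0) ((q i : ℝ) - y ^ i * q 0)
    have t8 : E = 8 * C * w + 2 * ((n : ℝ) ^ 2 * B ^ n) * (2 ^ (n + 4) * C ^ 3) * w := by
      rw [hE, hM]; ring
    have t9 : 0 ≤ C * w := by positivity
    linarith
  have hkill : Kill (fun i => p i - q i) (n - j) f := by
    intro i hi
    rw [ell_sub_fun, hkx i hi, hky i hi, sub_zero]
  have hmin : IsMin (fun i => p i - q i) (n - j) f := by
    refine isMin_of_irreducible Dx.irr (by omega) hkill (by omega) ?_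
    obtain ⟨i, hi, hne⟩ := hne
    exact ⟨i, hi, sub_ne_zero.2 hne⟩
  have hCE : C4 * E ≤ 1 := by
    have : C4 * M * w ≤ C4 * M * (h1 ^ 2 * w) := by gcongr
    rw [hE]; linarith
  have hEh : E * h1 ≤ 1 := by
    have : M * (h1 * w) ≤ M * (h1 ^ 2 * w) := by gcongr
    rw [hE]; linarith
  have h := hph x E (h1 ^ d * E) σ |((p 0 - q 0 : ℤ) : ℝ)| (n - j) (n - d - j + 1)
    (fun i => p i - q i) f hx (by omega) (Nat.sub_le _ _) hσE le_rfl hE0 hEE1 hCE herr hf0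
    (by omega) (by omega) hEh (fun D hD hDk hk => hmin.dvd hk (by omega))
  rw [show n - d - j + 1 + 1 - f.natDegree = n + 2 - 2 * d - j by omega] at h
  push_cast at h
  set V := |(p 0 : ℝ) - q 0| with hV
  have hV0 : 0 ≤ V := abs_nonneg _
  have hsplit : C4 * (V + (h1 ^ d * E) ^ 2 / E) * E ^ (d - 1) =
      C4 * V * E ^ (d - 1) + C4 * (h1 ^ 2 * E) ^ d := by
    obtain ⟨d', hd'⟩ : ∃ d', d = d' + 1 := ⟨d - 1, by omega⟩
    rw [hd', Nat.add_sub_cancel, mul_pow (h1 ^ (d' + 1)) E, mul_pow (h1 ^ 2) E, ← pow_mul, ← pow_mul]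
    field_simp
    ring
  change _ ≤ C4 * (V + (h1 ^ d * E) ^ 2 / E) * E ^ (d - 1) at h
  rw [hsplit] at h
  have hlow : C4 * (h1 ^ 2 * E) ^ d ≤ 1 / 2 := by
    have e1 : h1 ^ 2 * E ≤ 1 := by rw [hE]; linarith
    have e2 : (h1 ^ 2 * E) ^ d ≤ h1 ^ 2 * E := pow_le_of_le_one (by positivity) e1 (by omega)
    calc C4 * (h1 ^ 2 * E) ^ d ≤ C4 * (h1 ^ 2 * E) := by gcongr
      _ = C4 * M * (h1 ^ 2 * w) := by rw [hE]; ring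
      _ ≤ _ := hsm
  have hone : 1 ≤ h1 ^ (n + 2 - 2 * d - j) := one_le_pow₀ hh1
  have hfin : C4 * V * E ^ (d - 1) ≤ C4 * V * (M ^ n * w ^ (d - 1)) := by
    rw [hE, mul_pow M w]
    have : M ^ (d - 1) ≤ M ^ n := pow_le_pow_right₀ hM1 (by omega)
    gcongr
  calc h1 ^ (n + 2 - 2 * d - j) ≤ 2 * (C4 * V * E ^ (d - 1)) := by linarith
    _ ≤ 2 * (C4 * V * (M ^ n * w ^ (d - 1))) := by linarith
    _ = _ := by ring

lemma same_close {m n : ℕ} (hn1 : 2 * m + 1 ≤ n) {C H e x y : ℝ} {f : ℤ[X]} {α : ℂ}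
    {p q : ℕ → ℤ} {g g' : ℝ} {j : ℕ} {γ u : ℝ} (hC : 0 ≤ C) (he : 0 < e)
    (Dx : Dat m n C H e x f α p g j) (Dy : Dat m n C H e y f α q g' j) (hg : g ≤ 2 * γ)
    (hg' : g' ≤ 2 * γ) (hu : 1 ≤ u) (hup : u ≤ |(p 0 : ℝ)|) (hpq : ∀ i ≤ n - j, p i = q i) :
    |x - y| ≤ 4 * C * (γ * e) / u := by
  have hd1 := Dx.one_le_d
  have hdj := Dx.dj
  have t1 := Dx.approx 1 (by omega)
  have t2 := Dy.approx 1 (by omega)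
  rw [← hpq 1 (by omega), ← hpq 0 (by omega)] at t2
  rw [pow_one] at t1 t2
  have t3 : |(x - y) * (p 0 : ℝ)| ≤ C * g * e + C * g' * e := by
    rw [show (x - y) * (p 0 : ℝ) = ((p 1 : ℝ) - y * p 0) - ((p 1 : ℝ) - x * p 0) by ring]
    refine (abs_sub _ _).trans (by linarith)
  have t5 : C * g * e ≤ C * (2 * γ) * e := by gcongr
  have t6 : C * g' * e ≤ C * (2 * γ) * e := by gcongr
  rw [abs_mul] at t3
  rw [le_div_iff₀ (by linarith)]
  have : |x - y| * u ≤ |x - y| * |(p 0 : ℝ)| := by gcongr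
  linarith

lemma root_close {m n : ℕ} {C H e x y : ℝ} {f : ℤ[X]} {α : ℂ}
    {p q : ℕ → ℤ} {g g' : ℝ} {j : ℕ} {γ u : ℝ} (hC : 0 ≤ C) (he : 0 < e)
    (Dx : Dat m n C H e x f α p g j) (Dy : Dat m n C H e y f α q g' j) (hγ : 1 ≤ γ) (hg : g ≤ 2 * γ)
    (hg' : g' ≤ 2 * γ) (hu : 1 ≤ u) (hup : u ≤ |(p 0 : ℝ)|) (huq : u ≤ |(q 0 : ℝ)|) :
    |x - y| ≤ 4 * C * hh f ^ f.natDegree * (γ * e) / u := by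
  have hh1 := hh_nonneg f
  have aux : ∀ (t G V : ℝ), t ≤ C * hh f ^ f.natDegree * G * e / V → G ≤ 2 * γ → u ≤ V →
      t ≤ 2 * C * hh f ^ f.natDegree * (γ * e) / u := by
    intro t G V h1' h2' h3'
    refine h1'.trans ?_
    have : C * hh f ^ f.natDegree * G * e / V ≤ C * hh f ^ f.natDegree * (2 * γ) * e / u := by gcongr
    refine this.trans (le_of_eq (by ring))
  have h3 := aux _ _ _ Dx.near hg hup
  have h4 := aux _ _ _ Dy.near hg' huq
  have h5 : ‖((x - y : ℝ) : ℂ)‖ ≤ ‖(x : ℂ) - α‖ + ‖(y : ℂ) - α‖ := by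
    rw [show ((x - y : ℝ) : ℂ) = ((x : ℂ) - α) - ((y : ℂ) - α) by push_cast; ring]
    exact norm_sub_le _ _
  rw [Complex.norm_real, Real.norm_eq_abs] at h5
  have : 4 * C * hh f ^ f.natDegree * (γ * e) / u = 2 * C * hh f ^ f.natDegree * (γ * e) / u +
    2 * C * hh f ^ f.natDegree * (γ * e) / u := by ring
  linarith

end
end SimDioph

namespace SimDioph
open Polynomial

noncomputable section

lemma exponent_lemma (m n d j : ℕ) (hn1 : 2 * m + 1 ≤ n) (hd : 1 ≤ d)
    (hdj : d + j ≤ m + 1) (s ε c L Lam Y Z V : ℝ) (hs1 : 1 / 2 ≤ s) (hs2 : s < 1)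
    (hsn : (m : ℝ) + 2 ≤ (n + 2) * s) (hε : 0 ≤ ε) (hc : 0 ≤ c) (hL : 0 ≤ L) (hLam : L = n * Lam)
    (hY : 0 ≤ Y) (hZ : 0 ≤ Z) (hE : Y + Z ≤ c + Lam)
    (hF : V + (n + 1 - d - 2 * j) * Z ≤ c + L + j * (Y - (2 * Lam + ε * L))) :
    Y * (d + 1) + s * (d * Y + Z - (2 * Lam + ε * L) - V) ≤ (2 * d + 1) * c - ε * s * L ∨
    Y * (3 * d + j - n - 1) + V + (d - 1) * (Z - (2 * Lam + ε * L)) +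
      s * (Z - (2 * Lam + ε * L) - V) ≤ (2 * d + 1) * c - ε * s * L := by
  have hd' : (1 : ℝ) ≤ d := by exact_mod_cast hd
  have hj' : (0 : ℝ) ≤ j := Nat.cast_nonneg j
  have hdj' : (d : ℝ) + j ≤ m + 1 := by exact_mod_cast hdj
  have hn1' : 2 * (m : ℝ) + 1 ≤ n := by exact_mod_cast hn1
  have hεL : 0 ≤ ε * L := mul_nonneg hε hL
  have hs0 : 0 < s := by linarith
  set A : ℝ := (1 - s) * (n - 2 * j) - 2 * (d - 1 + s) with hA
  by_cases hA0 : A ≤ 0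
  · right
    have h1 := mul_le_mul_of_nonneg_left hF (by linarith : 0 ≤ 1 - s)
    have h2 : 0 ≤ (-A) * (c + Lam - Y - Z) := mul_nonneg (by linarith) (by linarith)
    have hBc : (d : ℝ) + j + 1 - (n + 2) * s - (1 - s) * j ≤ 0 := by
      have : 0 ≤ (1 - s) * (j : ℝ) := mul_nonneg (by linarith) hj'
      linarith
    have h3 : 0 ≤ Y * (-((d : ℝ) + j + 1 - (n + 2) * s - (1 - s) * j)) :=
      mul_nonneg hY (by linarith)
    have h4 : 0 ≤ s * d * Z := by positivity
    have h5 : 0 ≤ (ε * L) * ((1 - s) * j + (d - 1)) :=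
      mul_nonneg hεL (add_nonneg (mul_nonneg (by linarith) hj') (by linarith))
    have h6 : 0 ≤ c * ((1 - s) * (n - 2 * j)) :=
      mul_nonneg hc (mul_nonneg (by linarith) (by linarith))
    have h7 : 0 ≤ c * (1 - s) := mul_nonneg hc (by linarith)
    subst hLam
    rw [hA] at h2
    linarith
  · have hA0 : 0 < A := not_le.1 hA0
    have hnj : 4 * (d : ℝ) - 2 < n - 2 * j := by
      by_contra hcon
      have : (1 - s) * ((n : ℝ) - 2 * j) ≤ (1 - s) * (4 * d - 2) :=
        mul_le_mul_of_nonneg_left (not_lt.1 hcon) (by linarith)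
      nlinarith
    have hineq : 4 * d + 2 * j ≤ n + 1 := by
      have : ((4 * d + 2 * j : ℕ) : ℝ) < ((n + 2 : ℕ) : ℝ) := by push_cast; linarith
      have := Nat.cast_lt.1 this
      omega
    have hineq' : 4 * (d : ℝ) + 2 * j ≤ n + 1 := by exact_mod_cast hineq
    have hbr : s * (3 * d + j - n - 1) + (1 - s) * (d + 1 + s * d) - 2 * (s * d) ≤ 0 := by
      have e1 : s * ((3 : ℝ) * d + j - n - 1) ≤ s * (-d) :=
        mul_le_mul_of_nonneg_left (by linarith) hs0.le
      have e2 : (1 - s) * ((d : ℝ) + 1) ≤ s * (2 * d) :=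
        mul_le_mul (by linarith) (by linarith) (by linarith) hs0.le
      have e3 : (1 - s) * (s * (d : ℝ)) ≤ 1 * (s * d) :=
        mul_le_mul_of_nonneg_right (by linarith) (by positivity)
      nlinarith
    by_contra hcon
    push Not at hcon
    obtain ⟨c1, c2⟩ := hcon
    have g1 := mul_lt_mul_of_pos_left c1 (by linarith : 0 < 1 - s)
    have g2 := mul_lt_mul_of_pos_left c2 hs0
    have g3 : Y * (s * (3 * d + j - n - 1) + (1 - s) * (d + 1 + s * d) - 2 * (s * d)) ≤ 0 :=
      mul_nonpos_of_nonneg_of_nonpos hY hbr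
    have g4 : 0 ≤ 2 * (s * d) * (c + Lam - Y - Z) := mul_nonneg (by positivity) (by linarith)
    have g5 : 0 ≤ s * d * Z := by positivity
    have g6 : 0 ≤ ε * L * (s * (d - 1)) := mul_nonneg hεL (mul_nonneg hs0.le (by linarith))
    have g7 : 0 ≤ c * (2 * d * (1 - s)) := mul_nonneg hc (mul_nonneg (by linarith) (by linarith))
    nlinarith

end
end SimDioph

namespace SimDioph
open Polynomial

noncomputable section

/-- `S` is covered by finitely many sets with total `s`-cost at most `c`. -/
def CovS (s : ℝ) (S : Set ℝ) (c : ℝ) : Prop :=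
  ∃ (ι : Type) (_ : Fintype ι) (t : ι → Set ℝ), S ⊆ ⋃ i, t i ∧
    ∑ i, Metric.ediam (t i) ^ s ≤ ENNReal.ofReal c

lemma CovS.mono {s c c' : ℝ} {S S' : Set ℝ} (h : CovS s S c) (hS : S' ⊆ S) (hc : c ≤ c') :
    CovS s S' c' := by
  obtain ⟨ι, i1, t, h1, h2⟩ := h
  exact ⟨ι, i1, t, hS.trans h1, h2.trans (ENNReal.ofReal_le_ofReal hc)⟩

lemma covS_biUnion {s c : ℝ} {κ : Type} (I : Finset κ) (S : κ → Set ℝ)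
    (h : ∀ i ∈ I, CovS s (S i) c) : CovS s (⋃ i ∈ I, S i) (I.card * c) := by
  choose ι hι t h1 h2 using fun i : I => h i.1 i.2
  refine ⟨Σ i : I, ι i, inferInstance, fun p => t p.1 p.2, ?_, ?_⟩
  · intro x hx
    simp only [Set.mem_iUnion] at hx
    obtain ⟨i, hi, hx⟩ := hx
    have := h1 ⟨i, hi⟩ hx
    simp only [Set.mem_iUnion] at this ⊢
    obtain ⟨k, hk⟩ := this
    exact ⟨⟨⟨i, hi⟩, k⟩, hk⟩
  · rw [Fintype.sum_sigma]
    calc _ ≤ ∑ i : I, ENNReal.ofReal c := Finset.sum_le_sum fun i _ => h2 i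
      _ = I.card * ENNReal.ofReal c := by simp
      _ = _ := by rw [ENNReal.ofReal_mul (Nat.cast_nonneg _), ENNReal.ofReal_natCast]

lemma covS_label {s δ N : ℝ} {L : Type} (F : Finset L) (S : Set ℝ) (lab : ℝ → L) (hs : 0 ≤ s)
    (hδ : 0 ≤ δ) (hN : (F.card : ℝ) ≤ N) (hlab : ∀ x ∈ S, lab x ∈ F)
    (hcl : ∀ x ∈ S, ∀ y ∈ S, lab x = lab y → |x - y| ≤ δ) : CovS s S (N * δ ^ s) := by
  refine ⟨F, inferInstance, fun l => {x ∈ S | lab x = l}, ?_, ?_⟩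
  · intro x hx
    simp only [Set.mem_iUnion]
    exact ⟨⟨lab x, hlab x hx⟩, hx, rfl⟩
  · have hb : ∀ l : F, Metric.ediam {x ∈ S | lab x = l} ^ s ≤ ENNReal.ofReal (δ ^ s) := by
      intro l
      rw [← ENNReal.ofReal_rpow_of_nonneg hδ hs]
      refine ENNReal.rpow_le_rpow (Metric.ediam_le ?_) hs
      rintro x ⟨hx, hx'⟩ y ⟨hy, hy'⟩
      rw [edist_dist, Real.dist_eq]
      exact ENNReal.ofReal_le_ofReal (hcl x hx y hy (hx'.trans hy'.symm))
    calc _ ≤ ∑ l : F, ENNReal.ofReal (δ ^ s) := Finset.sum_le_sum fun l _ => hb l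
      _ = F.card * ENNReal.ofReal (δ ^ s) := by simp
      _ = ENNReal.ofReal (F.card * δ ^ s) := by
          rw [ENNReal.ofReal_mul (Nat.cast_nonneg _), ENNReal.ofReal_natCast]
      _ ≤ _ := ENNReal.ofReal_le_ofReal (by gcongr)

lemma covS_empty (s c : ℝ) : CovS s ∅ c :=
  ⟨Empty, inferInstance, fun _ => ∅, by simp, by simp⟩

lemma covS_limsup {s : ℝ} (hs : 0 < s) (T : ℕ → Set ℝ) (a : ℕ → ℝ)
    (hsum : Summable a) (k0 : ℕ) (h : ∀ k ≥ k0, CovS s (T k) (a k)) (S : Set ℝ)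
    (hS : ∀ x ∈ S, ∀ K, ∃ k ≥ K, x ∈ T k) : μH[s] S = 0 := by
  choose ι hι t h1 h2 using fun k : ℕ => h (k + k0) (Nat.le_add_left _ _)
  set b : ℕ → ℝ≥0∞ := fun k => ENNReal.ofReal (a (k + k0)) with hb
  have hbsum : ∑' k, b k ≠ ∞ := by
    have : Summable fun k => a (k + k0) := (summable_nat_add_iff k0).2 hsum
    exact this.tsum_ofReal_ne_top
  have hb2 := ENNReal.tendsto_sum_nat_add b hbsum
  have hr : Filter.Tendsto (fun K => (∑' k, b (k + K)) ^ (1 / s)) Filter.atTop (nhds 0) := by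
    have h3 := (ENNReal.continuous_rpow_const (y := 1 / s)).tendsto (0 : ℝ≥0∞)
    rw [ENNReal.zero_rpow_of_pos (by positivity)] at h3
    exact h3.comp hb2
  have key := MeasureTheory.Measure.hausdorffMeasure_le_liminf_tsum
    (ι := fun K => Σ k : ℕ, ι (k + K)) s S
    (l := Filter.atTop) (fun K => (∑' k, b (k + K)) ^ (1 / s)) hr (fun K p => t (p.1 + K) p.2)
    (Filter.Eventually.of_forall ?_) (Filter.Eventually.of_forall ?_)
  · refine le_antisymm (key.trans ?_) zero_le
    have hle : ∀ K, ∑' p : (Σ k : ℕ, ι (k + K)), Metric.ediam (t (p.1 + K) p.2) ^ s ≤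
        ∑' k, b (k + K) := by
      intro K
      rw [ENNReal.tsum_sigma (fun k (i : ι (k + K)) => Metric.ediam (t (k + K) i) ^ s)]
      refine ENNReal.tsum_le_tsum fun k => ?_
      rw [tsum_fintype]
      exact h2 _
    calc _ ≤ Filter.liminf (fun K => ∑' k, b (k + K)) Filter.atTop :=
          Filter.liminf_le_liminf (Filter.Eventually.of_forall hle)
      _ = 0 := hb2.liminf_eq
  · rintro K ⟨k, i⟩
    have e1 : Metric.ediam (t (k + K) i) ^ s ≤ ∑' k, b (k + K) := by
      calc _ ≤ ∑ i, Metric.ediam (t (k + K) i) ^ s :=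
            Finset.single_le_sum (f := fun i => Metric.ediam (t (k + K) i) ^ s)
              (fun _ _ => zero_le) (Finset.mem_univ i)
        _ ≤ b (k + K) := h2 _
        _ ≤ _ := ENNReal.le_tsum k
    calc Metric.ediam (t (k + K) i) = (Metric.ediam (t (k + K) i) ^ s) ^ (1 / s) := by
          rw [← ENNReal.rpow_mul, mul_one_div_cancel hs.ne', ENNReal.rpow_one]
      _ ≤ _ := ENNReal.rpow_le_rpow e1 (by positivity)
  · intro K x hx
    obtain ⟨k, hk, hxk⟩ := hS x hx (K + k0)
    have e1 : k - K - k0 + K + k0 = k := by omega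
    have := h1 (k - K - k0 + K) (by rw [e1]; exact hxk)
    simp only [Set.mem_iUnion] at this ⊢
    obtain ⟨i, hi⟩ := this
    exact ⟨⟨k - K - k0, i⟩, hi⟩

end
end SimDioph

namespace SimDioph
open Polynomial

noncomputable section

/-- Integer polynomials of degree at most `d` with coefficients bounded by `A`. -/
def polyFin (d : ℕ) (A : ℝ) : Finset ℤ[X] := by
  classical
  exact (Fintype.piFinset fun _ : Fin (d + 1) => Finset.Icc (-(⌊A⌋₊ : ℤ)) (⌊A⌋₊ : ℤ)).image
    (fun v => ∑ i : Fin (d + 1), monomial (i : ℕ) (v i))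

lemma mem_polyFin {d : ℕ} {A : ℝ} {f : ℤ[X]} (hd : f.natDegree ≤ d)
    (hA : ∀ i, |(f.coeff i : ℝ)| ≤ A) : f ∈ polyFin d A := by
  classical
  unfold polyFin
  rw [Finset.mem_image]
  refine ⟨fun i => f.coeff i, ?_, ?_⟩
  · rw [Fintype.mem_piFinset]
    exact fun i => mem_Icc_of_abs (hA i)
  · rw [Fin.sum_univ_eq_sum_range (fun i => monomial i (f.coeff i)) (d + 1)]
    exact (f.as_sum_range' (d + 1) (by omega)).symm

lemma natDegree_polyFin {d : ℕ} {A : ℝ} {f : ℤ[X]} (hf : f ∈ polyFin d A) : f.natDegree ≤ d := by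
  classical
  unfold polyFin at hf
  rw [Finset.mem_image] at hf
  obtain ⟨v, _, rfl⟩ := hf
  refine natDegree_sum_le_of_forall_le _ _ fun i _ => (natDegree_monomial_le _).trans ?_
  omega

lemma card_polyFin {d : ℕ} {A : ℝ} (hA : 0 ≤ A) :
    ((polyFin d A).card : ℝ) ≤ (2 * A + 1) ^ (d + 1) := by
  classical
  unfold polyFin
  have h1 := Finset.card_image_le
    (s := Fintype.piFinset fun _ : Fin (d + 1) => Finset.Icc (-(⌊A⌋₊ : ℤ)) (⌊A⌋₊ : ℤ))
    (f := fun v => ∑ i : Fin (d + 1), monomial (i : ℕ) (v i))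
  rw [Fintype.card_piFinset] at h1
  have h2 := card_Icc_le hA
  calc _ ≤ (((∏ _i : Fin (d + 1), (Finset.Icc (-(⌊A⌋₊ : ℤ)) (⌊A⌋₊ : ℤ)).card : ℕ)) : ℝ) := by
        exact_mod_cast h1
    _ = ((Finset.Icc (-(⌊A⌋₊ : ℤ)) (⌊A⌋₊ : ℤ)).card : ℝ) ^ (d + 1) := by simp
    _ ≤ _ := by gcongr

/-- Pairs (polynomial, root). -/
def labF (d : ℕ) (A : ℝ) : Finset (Σ _ : ℤ[X], ℂ) := by
  classical
  exact (polyFin d A).sigma fun f => (f.map (Int.castRingHom ℂ)).roots.toFinset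

lemma mem_labF {d : ℕ} {A : ℝ} {f : ℤ[X]} {α : ℂ} (hd : f.natDegree ≤ d)
    (hA : ∀ i, |(f.coeff i : ℝ)| ≤ A) (hα : α ∈ (f.map (Int.castRingHom ℂ)).roots) :
    (⟨f, α⟩ : Σ _ : ℤ[X], ℂ) ∈ labF d A := by
  classical
  unfold labF
  rw [Finset.mem_sigma]
  exact ⟨mem_polyFin hd hA, Multiset.mem_toFinset.2 hα⟩

lemma card_labF {d : ℕ} {A : ℝ} (hA : 0 ≤ A) :
    ((labF d A).card : ℝ) ≤ (2 * A + 1) ^ (d + 1) * d := by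
  classical
  unfold labF
  rw [Finset.card_sigma]
  have h1 : ∑ f ∈ polyFin d A, ((f.map (Int.castRingHom ℂ)).roots.toFinset).card ≤
      (polyFin d A).card * d := by
    rw [← smul_eq_mul, ← Finset.sum_const]
    refine Finset.sum_le_sum fun f hf => ?_
    exact (Multiset.toFinset_card_le _).trans ((card_roots' _).trans
      (natDegree_map_le.trans (natDegree_polyFin hf)))
  have h2 := card_polyFin (d := d) hA
  calc _ ≤ (((polyFin d A).card * d : ℕ) : ℝ) := by exact_mod_cast h1
    _ = ((polyFin d A).card : ℝ) * d := by push_cast; ring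
    _ ≤ _ := by gcongr

/-- Dyadic class. -/
def Cls (m n : ℕ) (C B H e : ℝ) (d j : ℕ) (h γ u : ℝ) : Set ℝ :=
  {x | |x| ≤ B ∧ ∃ f α p g, Dat m n C H e x f α p g j ∧ f.natDegree = d ∧ h ≤ hh f ∧ hh f ≤ 2 * h ∧
    γ ≤ g ∧ g ≤ 2 * γ ∧ u ≤ |(p 0 : ℝ)| ∧ |(p 0 : ℝ)| ≤ 2 * u}

lemma labF_bound (n d : ℕ) (h : ℝ) (hh1 : 1 ≤ h) :
    ((labF d (2 ^ n * (2 * h))).card : ℝ) ≤ d * (2 ^ (n + 3)) ^ (d + 1) * h ^ (d + 1) := by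
  have h2n : (1 : ℝ) ≤ 2 ^ n := one_le_pow₀ (by norm_num)
  refine (card_labF (by positivity)).trans ?_
  rw [mul_assoc, ← mul_pow, mul_comm]
  gcongr
  rw [pow_add]
  nlinarith

lemma Cls_cover1 {m n : ℕ} (hn1 : 2 * m + 1 ≤ n) {C B H e s : ℝ} (hs : 0 ≤ s) (hC : 1 ≤ C)
    (he : 0 < e) (d j : ℕ) (h γ u : ℝ) (hh1 : 1 ≤ h) (hγ : 1 ≤ γ) (hu : 1 ≤ u) :
    CovS s (Cls m n C B H e d j h γ u)
      (d * (2 ^ (n + 3)) ^ (d + 1) * h ^ (d + 1) * (4 * C * (2 * h) ^ d * (γ * e) / u) ^ s) := by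
  classical
  have hex : ∀ x : ℝ, ∃ l : Σ _ : ℤ[X], ℂ, x ∈ Cls m n C B H e d j h γ u →
      ∃ p g, Dat m n C H e x l.1 l.2 p g j ∧ l.1.natDegree = d ∧ h ≤ hh l.1 ∧
    hh l.1 ≤ 2 * h ∧ γ ≤ g ∧ g ≤ 2 * γ ∧ u ≤ |(p 0 : ℝ)| ∧ |(p 0 : ℝ)| ≤ 2 * u := by
    intro x
    by_cases hx : x ∈ Cls m n C B H e d j h γ u
    · obtain ⟨_, f, α, p, g, h⟩ := hx
      exact ⟨⟨f, α⟩, fun _ => ⟨p, g, h⟩⟩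
    · exact ⟨⟨0, 0⟩, fun h => absurd h hx⟩
  choose lab hlab using hex
  refine covS_label (labF d (2 ^ n * (2 * h))) _ lab hs (by positivity) (labF_bound n d h hh1) ?_ ?_
  · intro x hx
    obtain ⟨p, g, D, hd, h1, h2, _⟩ := hlab x hx
    have := D.dj
    refine mem_labF hd.le (fun i => (coeff_le_hh _ n (by omega) i).trans ?_) D.root
    gcongr
  · intro x hx y hy hxy
    obtain ⟨p, g, D, hd, h1, h2, h3, h4, h5, h6⟩ := hlab x hx
    obtain ⟨p', g', D', hd', h1', h2', h3', h4', h5', h6'⟩ := hlab y hy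
    rw [← hxy] at D'
    have := root_close (γ := γ) (u := u) (by linarith) he D D' hγ h4 h4' hu h5 h5'
    refine this.trans ?_
    rw [hd]
    have := hh_nonneg (lab x).1
    gcongr

lemma Cls_cover2 (m n : ℕ) (hn1 : 2 * m + 1 ≤ n) (B : ℝ) (hB : 1 ≤ B) (C : ℝ) (hC : 1 ≤ C) :
    ∃ K δ : ℝ, 1 ≤ K ∧ 0 < δ ∧ ∀ (H e s : ℝ) (d j : ℕ) (h γ u : ℝ), 0 ≤ s → 1 ≤ H → 0 < e →
      e * H ^ 2 ≤ δ → 1 ≤ h → 1 ≤ γ → 1 ≤ u →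
      CovS s (Cls m n C B H e d j h γ u)
        (d * (2 ^ (n + 3)) ^ (d + 1) * h ^ (d + 1) *
          (K * u * (γ * e) ^ (d - 1) / h ^ (n + 2 - 2 * d - j)) * (4 * C * (γ * e) / u) ^ s) := by
  obtain ⟨C5, δ, hC5, hδ, hsep⟩ := sep m n hn1 B hB C hC
  refine ⟨4 * C5 + 3 * 2 ^ n * C, δ, ?_, hδ, ?_⟩
  · have : 0 ≤ 3 * 2 ^ n * C := by positivity
    linarith
  intro H e s d j h γ u hs hH he heδ hh1 hγ hu
  rcases (Cls m n C B H e d j h γ u).eq_empty_or_nonempty with hemp | ⟨x0, hx0⟩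
  · rw [hemp]; exact covS_empty _ _
  set N := n + 2 - 2 * d - j with hN
  set w := γ * e with hw
  have hw0 : 0 < w := by positivity
  set gap : ℝ := h ^ N / (C5 * w ^ (d - 1)) with hgap
  have hgap0 : 0 < gap := by positivity
  have hugap : u / gap = C5 * u * w ^ (d - 1) / h ^ N := by rw [hgap]; field_simp
  have hone : 1 ≤ 2 ^ n * C * u * w ^ (d - 1) / h ^ N := by
    obtain ⟨_, f, α, p, g, D, hd, h1, h2, h3, h4, h5, h6⟩ := hx0
    have bG := D.bG
    have hd1 := D.one_le_d
    have hdj := D.dj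
    rw [hd] at bG hd1 hdj
    have hge : g * e ≤ 2 * w := by rw [hw, ← mul_assoc]; gcongr
    rw [le_div_iff₀ (by positivity), one_mul]
    have hg0 := D.one_le_g
    calc h ^ N ≤ hh f ^ N := by gcongr
      _ ≤ C * |(p 0 : ℝ)| * (g * e) ^ (d - 1) := bG
      _ ≤ C * (2 * u) * (2 * w) ^ (d - 1) := by gcongr
      _ = 2 ^ (d - 1 + 1) * C * u * w ^ (d - 1) := by rw [mul_pow 2 w, pow_succ]; ring
      _ ≤ _ := by
        have : (2 : ℝ) ^ (d - 1 + 1) ≤ 2 ^ n := pow_le_pow_right₀ (by norm_num) (by omega)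
        gcongr
  have hex : ∀ x : ℝ, ∃ l : (Σ _ : ℤ[X], ℂ) × (ℕ → ℤ), x ∈ Cls m n C B H e d j h γ u →
      ∃ g, Dat m n C H e x l.1.1 l.1.2 l.2 g j ∧ l.1.1.natDegree = d ∧ h ≤ hh l.1.1 ∧
    hh l.1.1 ≤ 2 * h ∧ γ ≤ g ∧ g ≤ 2 * γ ∧ u ≤ |(l.2 0 : ℝ)| ∧ |(l.2 0 : ℝ)| ≤ 2 * u := by
    intro x
    by_cases hx : x ∈ Cls m n C B H e d j h γ u
    · obtain ⟨_, f, α, p, g, h⟩ := hx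
      exact ⟨⟨⟨f, α⟩, p⟩, fun _ => ⟨g, h⟩⟩
    · exact ⟨⟨⟨0, 0⟩, 0⟩, fun h => absurd h hx⟩
  choose lab hlab using hex
  set T : ℝ := 2 * u / gap + 1 with hT
  have hT0 : 0 ≤ T := by positivity
  have hdiff : ∀ {a b : ℝ}, ⌊a / gap⌋ = ⌊b / gap⌋ → |a - b| < gap := by
    intro a b hab
    have := Int.abs_sub_lt_one_of_floor_eq_floor hab
    rw [← sub_div, abs_div, abs_of_pos hgap0, div_lt_one hgap0] at this
    exact this
  refine covS_label ((labF d (2 ^ n * (2 * h))) ×ˢ (Finset.Icc (-(⌊T⌋₊ : ℤ)) (⌊T⌋₊ : ℤ))) _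
    (fun x => ((lab x).1, ⌊((lab x).2 0 : ℝ) / gap⌋)) hs (by positivity) ?_ ?_ ?_
  · rw [Finset.card_product]
    push_cast
    have h1 := labF_bound n d h hh1
    have h2 := card_Icc_le hT0
    have h3 : 2 * T + 1 ≤ (4 * C5 + 3 * 2 ^ n * C) * u * w ^ (d - 1) / h ^ N := by
      have e1 : 2 * T + 1 = 4 * (u / gap) + 3 := by rw [hT]; ring
      have e2 : (4 * C5 + 3 * 2 ^ n * C) * u * w ^ (d - 1) / h ^ N =
        4 * (C5 * u * w ^ (d - 1) / h ^ N) + 3 * (2 ^ n * C * u * w ^ (d - 1) / h ^ N) := by ring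
      rw [e1, e2, hugap]
      linarith
    have h4 := h2.trans h3
    gcongr
  · intro x hx
    obtain ⟨g, D, hd, h1, h2, h3, h4, h5, h6⟩ := hlab x hx
    have hdj := D.dj
    rw [hd] at hdj
    rw [Finset.mem_product]
    refine ⟨mem_labF hd.le (fun i => (coeff_le_hh (lab x).1.1 n (by rw [hd]; omega) i).trans
      (by gcongr)) D.root, ?_⟩
    apply mem_Icc_of_abs
    set z := ((lab x).2 0 : ℝ) / gap with hz
    have hz1 : |z| ≤ 2 * u / gap := by
      rw [hz, abs_div, abs_of_pos hgap0]; gcongr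
    have f1 := Int.floor_le z
    have f2 := Int.lt_floor_add_one z
    rw [abs_le] at hz1 ⊢
    constructor <;> linarith
  · intro x hx y hy hxy
    obtain ⟨g, D, hd, h1, h2, h3, h4, h5, h6⟩ := hlab x hx
    obtain ⟨g', D', hd', h1', h2', h3', h4', h5', h6'⟩ := hlab y hy
    obtain ⟨hxy1, hxy2⟩ := Prod.mk.inj hxy
    rw [← hxy1] at D'
    refine same_close hn1 (by linarith) he D D' h4 h4' hu h5 ?_
    by_contra hne
    push Not at hne
    have hs1 := hsep H e x y _ _ _ _ g g' j γ u hH he heδ hx.1 hy.1 D D' hγ h3 h4 h4' hu h5 h6 h5' h6' hne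
    have hlt := hdiff hxy2
    rw [hd] at hs1
    have : h ^ N ≤ hh (lab x).1.1 ^ N := by gcongr
    have h7 : h ^ N ≤ C5 * |((lab x).2 0 : ℝ) - (lab y).2 0| * w ^ (d - 1) := this.trans hs1
    have h8 : C5 * w ^ (d - 1) * |((lab x).2 0 : ℝ) - (lab y).2 0| < C5 * w ^ (d - 1) * gap := by
      gcongr
    have h9 : C5 * w ^ (d - 1) * gap = h ^ N := by rw [hgap]; field_simp
    linarith

end
end SimDioph

namespace SimDioph
open Polynomial

noncomputable section

set_option maxHeartbeats 1000000 in
lemma Cls_cover (m n : ℕ) (hn1 : 2 * m + 1 ≤ n) (B : ℝ) (hB : 1 ≤ B)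
    (C : ℝ) (hC : 1 ≤ C) (s ε : ℝ) (hs1 : 1 / 2 ≤ s) (hs2 : s < 1)
    (hsn : (m : ℝ) + 2 ≤ (n + 2) * s) (hε : 0 ≤ ε) :
    ∃ K δ : ℝ, 1 ≤ K ∧ 0 < δ ∧ ∀ (L Lam : ℝ) (d j a b c : ℕ), 0 ≤ L → 0 ≤ Lam → L = n * Lam →
      (2 : ℝ) ^ (-(2 * Lam + ε * L)) * ((2 : ℝ) ^ Lam) ^ 2 ≤ δ →
      CovS s (Cls m n C B ((2 : ℝ) ^ Lam) ((2 : ℝ) ^ (-(2 * Lam + ε * L))) d j (2 ^ a) (2 ^ b) (2 ^ c))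
        (K * (2 : ℝ) ^ (-(ε * s * L))) := by
  obtain ⟨K2, δ, hK2, hδ, hcov2⟩ := Cls_cover2 m n hn1 B hB C hC
  have h2n : (1 : ℝ) ≤ 2 ^ n := one_le_pow₀ (by norm_num)
  have hC2 : 1 ≤ C * 2 ^ n := one_le_mul_of_one_le_of_one_le hC h2n
  set c0 : ℝ := Real.logb 2 (C * 2 ^ n) with hc0
  have hc00 : 0 ≤ c0 := Real.logb_nonneg (by norm_num) hC2
  have h2c0 : (2 : ℝ) ^ c0 = C * 2 ^ n :=
    Real.rpow_logb (by norm_num) (by norm_num) (by positivity)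
  set K0 : ℝ := n * (2 ^ (n + 3)) ^ (n + 1) * K2 * (4 * C * 2 ^ n) * (C * 2 ^ n) ^ (2 * n + 1) with hK0
  have hn0 : (1 : ℝ) ≤ n := by exact_mod_cast (by omega : 1 ≤ n)
  have hp3 : (1 : ℝ) ≤ (2 ^ (n + 3)) ^ (n + 1) := one_le_pow₀ (one_le_pow₀ (by norm_num))
  have h4C : 1 ≤ 4 * C * 2 ^ n := by nlinarith
  have hCp : 1 ≤ (C * 2 ^ n) ^ (2 * n + 1) := one_le_pow₀ hC2
  have hK01 : 1 ≤ K0 := by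
    refine one_le_mul_of_one_le_of_one_le (one_le_mul_of_one_le_of_one_le
      (one_le_mul_of_one_le_of_one_le (one_le_mul_of_one_le_of_one_le hn0 hp3) hK2) h4C) hCp
  refine ⟨K0, δ, hK01, hδ, ?_⟩
  intro L Lam d j a b c hL hLam hLn heδ
  set lk : ℝ := 2 * Lam + ε * L with hlk
  set H : ℝ := (2 : ℝ) ^ Lam with hH
  set e : ℝ := (2 : ℝ) ^ (-lk) with he
  have he0 : 0 < e := by positivity
  have hH1 : 1 ≤ H := Real.one_le_rpow (by norm_num) hLam
  have hs0 : 0 ≤ s := by linarith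
  rcases (Cls m n C B H e d j (2 ^ a) (2 ^ b) (2 ^ c)).eq_empty_or_nonempty with hemp | ⟨x0, hx0⟩
  · rw [hemp]; exact covS_empty _ _
  obtain ⟨_, f, α, p, g, D, hd, h1, h2, h3, h4, h5, h6⟩ := hx0
  have hd1 := D.one_le_d
  have hdj := D.dj
  have hEE := D.hg
  have hFF := D.bF
  rw [hd] at hd1 hdj hFF
  have hpow : ∀ k : ℕ, (1 : ℝ) ≤ 2 ^ k := fun k => one_le_pow₀ (by norm_num)
  have two_inj : ∀ {y z : ℝ}, (2 : ℝ) ^ y ≤ (2 : ℝ) ^ z → y ≤ z := fun h =>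
    (Real.rpow_le_rpow_left_iff (by norm_num)).1 h
  have hg0 := D.one_le_g
  have hhf := one_le_hh D.irr.ne_zero
  have hE : (a : ℝ) + b ≤ c0 + Lam := by
    apply two_inj
    rw [Real.rpow_add two_pos, Real.rpow_add two_pos, Real.rpow_natCast, Real.rpow_natCast, h2c0]
    calc (2 : ℝ) ^ a * 2 ^ b ≤ hh f * g := by gcongr
      _ ≤ C * H := hEE
      _ ≤ C * 2 ^ n * H := by nlinarith [mul_nonneg (by linarith : 0 ≤ C) (by linarith : 0 ≤ H)]
  have hjn : j ≤ n := by omega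
  have hF : (c : ℝ) + (n + 1 - d - 2 * j) * b ≤ c0 + L + j * (a - lk) := by
    apply two_inj
    have ecast : ((n : ℝ) + 1 - d - 2 * j) = ((n + 1 - d - 2 * j : ℕ) : ℝ) := by
      rw [Nat.sub_sub, Nat.cast_sub (by omega)]; push_cast; ring
    have e1 : (2 : ℝ) ^ ((c : ℝ) + (n + 1 - d - 2 * j) * b) = 2 ^ c * (2 ^ b) ^ (n + 1 - d - 2 * j) := by
      rw [ecast, Real.rpow_add two_pos, Real.rpow_natCast, mul_comm (_ : ℝ) (b : ℝ), Real.rpow_mul two_pos.le,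
        Real.rpow_natCast, Real.rpow_natCast]
    have e2 : (2 : ℝ) ^ (c0 + L + j * (a - lk)) = C * 2 ^ n * H ^ n * (2 ^ a * e) ^ j := by
      rw [Real.rpow_add two_pos, Real.rpow_add two_pos, h2c0, mul_comm (j : ℝ), Real.rpow_mul two_pos.le,
        Real.rpow_natCast, sub_eq_add_neg, Real.rpow_add two_pos, Real.rpow_natCast, hLn,
        mul_comm (n : ℝ), Real.rpow_mul two_pos.le, Real.rpow_natCast]
    rw [e1, e2]
    calc (2 : ℝ) ^ c * (2 ^ b) ^ (n + 1 - d - 2 * j) ≤ |(p 0 : ℝ)| * g ^ (n + 1 - d - 2 * j) := by gcongr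
      _ ≤ C * H ^ n * (hh f * e) ^ j := hFF
      _ ≤ C * H ^ n * (2 * 2 ^ a * e) ^ j := by gcongr
      _ = C * 2 ^ j * H ^ n * (2 ^ a * e) ^ j := by rw [mul_assoc 2, mul_pow 2]; ring
      _ ≤ _ := by
        have : (2 : ℝ) ^ j ≤ 2 ^ n := pow_le_pow_right₀ (by norm_num) hjn
        gcongr
  have hdn : d ≤ n := by omega
  have hdn' : (d : ℝ) ≤ n := by exact_mod_cast hdn
  -- the final exponential bound
  have hfin : ∀ t : ℝ, t ≤ (2 * d + 1) * c0 - ε * s * L →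
      (2 : ℝ) ^ t ≤ (C * 2 ^ n) ^ (2 * n + 1) * (2 : ℝ) ^ (-(ε * s * L)) := by
    intro t ht
    calc (2 : ℝ) ^ t ≤ (2 : ℝ) ^ (c0 * ((2 * n + 1 : ℕ) : ℝ) + -(ε * s * L)) := by
          apply Real.rpow_le_rpow_of_exponent_le (by norm_num)
          push_cast
          nlinarith
      _ = _ := by
        rw [Real.rpow_add two_pos, Real.rpow_mul two_pos.le, h2c0, Real.rpow_natCast]
  have hcst : (d : ℝ) * (2 ^ (n + 3)) ^ (d + 1) ≤ n * (2 ^ (n + 3)) ^ (n + 1) := by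
    have : ((2 : ℝ) ^ (n + 3)) ^ (d + 1) ≤ (2 ^ (n + 3)) ^ (n + 1) :=
      pow_le_pow_right₀ (one_le_pow₀ (by norm_num)) (by omega)
    gcongr
  have hsle : ∀ z : ℝ, 1 ≤ z → z ≤ 4 * C * 2 ^ n → z ^ s ≤ 4 * C * 2 ^ n := by
    intro z hz1 hz2
    calc z ^ s ≤ z ^ (1 : ℝ) := Real.rpow_le_rpow_of_exponent_le hz1 hs2.le
      _ = z := Real.rpow_one z
      _ ≤ _ := hz2
  rcases exponent_lemma m n d j hn1 hd1 hdj s ε c0 L Lam a b c hs1 hs2 hsn hε hc00 hL hLn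
    (Nat.cast_nonneg a) (Nat.cast_nonneg b) hE hF with hcost | hcost
  · refine (Cls_cover1 hn1 hs0 hC he0 d j (2 ^ a) (2 ^ b) (2 ^ c) (hpow a) (hpow b) (hpow c)).mono
      subset_rfl ?_
    have q1 : 4 * C * (2 * 2 ^ a) ^ d * (2 ^ b * e) / 2 ^ c =
        (4 * C * 2 ^ d) * (2 : ℝ) ^ ((d : ℝ) * a + b - lk - c) := by
      rw [sub_eq_add_neg _ lk, Real.rpow_sub two_pos, Real.rpow_add two_pos, Real.rpow_add two_pos,
        mul_comm (d : ℝ), Real.rpow_mul two_pos.le, Real.rpow_natCast, Real.rpow_natCast,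
        Real.rpow_natCast, Real.rpow_natCast, mul_pow]
      ring
    have q2 : ((2 : ℝ) ^ a) ^ (d + 1) = (2 : ℝ) ^ ((a : ℝ) * (d + 1)) := by
      rw [← Real.rpow_natCast, ← Real.rpow_natCast, ← Real.rpow_mul two_pos.le]; push_cast; rfl
    rw [q1, Real.mul_rpow (by positivity) (by positivity), ← Real.rpow_mul two_pos.le, q2]
    have q3 : (4 * C * 2 ^ d) ^ s ≤ 4 * C * 2 ^ n := by
      apply hsle
      · nlinarith [hpow d]
      · have : (2 : ℝ) ^ d ≤ 2 ^ n := pow_le_pow_right₀ (by norm_num) hdn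
        gcongr
    have q4 := hfin _ hcost
    have q5 : (2 : ℝ) ^ ((a : ℝ) * (d + 1)) * (2 : ℝ) ^ (((d : ℝ) * a + b - lk - c) * s) =
        (2 : ℝ) ^ ((a : ℝ) * (d + 1) + s * (d * a + b - lk - c)) := by
      rw [← Real.rpow_add two_pos]; ring_nf
    calc _ = (d * (2 ^ (n + 3)) ^ (d + 1)) * 1 * (4 * C * 2 ^ d) ^ s *
          ((2 : ℝ) ^ ((a : ℝ) * (d + 1)) * (2 : ℝ) ^ (((d : ℝ) * a + b - lk - c) * s)) := by ring
      _ ≤ (n * (2 ^ (n + 3)) ^ (n + 1)) * K2 * (4 * C * 2 ^ n) *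
          ((C * 2 ^ n) ^ (2 * n + 1) * (2 : ℝ) ^ (-(ε * s * L))) := by
          rw [q5]
          gcongr
      _ = _ := by rw [hK0]; ring
  · refine (hcov2 H e s d j (2 ^ a) (2 ^ b) (2 ^ c) hs0 hH1 he0 heδ (hpow a) (hpow b) (hpow c)).mono
      subset_rfl ?_
    have q1 : 4 * C * (2 ^ b * e) / 2 ^ c = (4 * C) * (2 : ℝ) ^ ((b : ℝ) - lk - c) := by
      rw [sub_eq_add_neg _ lk, Real.rpow_sub two_pos, Real.rpow_add two_pos, Real.rpow_natCast,
        Real.rpow_natCast]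
      ring
    obtain ⟨d', rfl⟩ : ∃ d', d = d' + 1 := ⟨d - 1, by omega⟩
    have hNle : 2 * (d' + 1) + j ≤ n + 2 := by omega
    have q2 : ((2 : ℝ) ^ a) ^ (d' + 1 + 1) * (K2 * 2 ^ c * (2 ^ b * e) ^ (d' + 1 - 1) /
        (2 ^ a) ^ (n + 2 - 2 * (d' + 1) - j)) = K2 * (2 : ℝ) ^ ((a : ℝ) * (3 * (d' + 1) + j - n - 1) + c
          + d' * (b - lk)) := by
      have r1 : (2 : ℝ) ^ (d' * ((b : ℝ) - lk)) = (2 ^ b * e) ^ d' := by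
        rw [mul_comm, Real.rpow_mul two_pos.le, Real.rpow_natCast, sub_eq_add_neg, Real.rpow_add two_pos,
          Real.rpow_natCast]
      have r2 : (2 : ℝ) ^ ((a : ℝ) * (3 * (d' + 1) + j - n - 1)) = (2 ^ a) ^ (d' + 1 + 1) /
          (2 ^ a) ^ (n + 2 - 2 * (d' + 1) - j) := by
        have : ((a : ℝ) * (3 * (d' + 1) + j - n - 1)) = (a : ℝ) * ((d' + 1 + 1 : ℕ) : ℝ) -
            (a : ℝ) * ((n + 2 - 2 * (d' + 1) - j : ℕ) : ℝ) := by
          rw [Nat.sub_sub, Nat.cast_sub hNle]; push_cast; ring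
        rw [this, Real.rpow_sub two_pos, Real.rpow_mul two_pos.le, Real.rpow_mul two_pos.le,
          Real.rpow_natCast, Real.rpow_natCast, Real.rpow_natCast]
      rw [Real.rpow_add two_pos, Real.rpow_add two_pos, r1, r2, Nat.add_sub_cancel, Real.rpow_natCast]
      ring
    rw [q1, Real.mul_rpow (by positivity) (by positivity), ← Real.rpow_mul two_pos.le]
    have q3 : (4 * C) ^ s ≤ 4 * C * 2 ^ n := by
      apply hsle
      · linarith
      · nlinarith
    push_cast at hcost
    have q4 := hfin _ (by push_cast; exact hcost)
    have q5 : (2 : ℝ) ^ ((a : ℝ) * (3 * (d' + 1) + j - n - 1) + c + d' * (b - lk)) *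
        (2 : ℝ) ^ (((b : ℝ) - lk - c) * s) =
        (2 : ℝ) ^ ((a : ℝ) * (3 * (d' + 1) + j - n - 1) + c + (d' + 1 - 1) * (b - lk) +
          s * (b - lk - c)) := by
      rw [← Real.rpow_add two_pos]; ring_nf
    calc _ = ((d' + 1 : ℕ) * (2 ^ (n + 3)) ^ (d' + 1 + 1)) * (((2 : ℝ) ^ a) ^ (d' + 1 + 1) *
          (K2 * 2 ^ c * (2 ^ b * e) ^ (d' + 1 - 1) / (2 ^ a) ^ (n + 2 - 2 * (d' + 1) - j))) *
          ((4 * C) ^ s * (2 : ℝ) ^ (((b : ℝ) - lk - c) * s)) := by ring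
      _ = ((d' + 1 : ℕ) * (2 ^ (n + 3)) ^ (d' + 1 + 1)) * K2 * (4 * C) ^ s *
          ((2 : ℝ) ^ ((a : ℝ) * (3 * (d' + 1) + j - n - 1) + c + d' * (b - lk)) *
        (2 : ℝ) ^ (((b : ℝ) - lk - c) * s)) := by rw [q2]; ring
      _ ≤ (n * (2 ^ (n + 3)) ^ (n + 1)) * K2 * (4 * C * 2 ^ n) *
          ((C * 2 ^ n) ^ (2 * n + 1) * (2 : ℝ) ^ (-(ε * s * L))) := by
          rw [q5]
          gcongr
      _ = _ := by rw [hK0]; ring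

end
end SimDioph

namespace SimDioph
open Polynomial

noncomputable section

/-- Points with a good approximation with denominator in a dyadic range. -/
def TT (n : ℕ) (B l : ℝ) (k : ℕ) : Set ℝ :=
  {x | |x| ≤ B ∧ ∃ q : ℕ, 2 ^ k ≤ q ∧ q < 2 ^ (k + 1) ∧
    ∀ i ∈ Finset.Icc 1 n, |(q : ℝ) * x ^ i - round ((q : ℝ) * x ^ i)| ≤ (q : ℝ) ^ (-l)}

lemma pow_near_le {y : ℝ} (hy : 1 ≤ y) {N : ℕ} (hN : y ≤ 2 ^ N) :
    ∃ a : ℕ, a ≤ N ∧ (2 : ℝ) ^ a ≤ y ∧ y ≤ 2 * 2 ^ a := by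
  obtain ⟨a, h1, h2⟩ := exists_nat_pow_near hy (one_lt_two)
  refine ⟨a, ?_, h1, by rw [pow_succ] at h2; linarith⟩
  have := h1.trans hN
  exact (pow_le_pow_iff_right₀ (one_lt_two)).1 this

lemma TT_sub (m n : ℕ) (hn1 : 2 * m + 1 ≤ n) (hn2 : n ≤ 2 * m + 2) (B : ℝ) (hB : 1 ≤ B)
    (ε : ℝ) (hε : 0 < ε) :
    ∃ (C δ : ℝ) (c1 : ℕ), 1 ≤ C ∧ 0 < δ ∧ ∀ k : ℕ, (2 : ℝ) ^ (-(ε * k)) ≤ δ →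
      TT n B (2 / n + ε) k ⊆
        ⋃ t ∈ (Finset.range (n + 1) ×ˢ Finset.range (n + 1)) ×ˢ
          (Finset.range (k + c1 + 1) ×ˢ Finset.range (k + c1 + 1) ×ˢ Finset.range (k + c1 + 1)),
          Cls m n C B ((2 : ℝ) ^ ((k : ℝ) / n)) ((2 : ℝ) ^ (-(2 * ((k : ℝ) / n) + ε * k)))
            t.1.1 t.1.2 (2 ^ t.2.1) (2 ^ t.2.2.1) (2 ^ t.2.2.2) := by
  obtain ⟨C, δ, hC, hδ, hδ1, hper⟩ := perx m n hn1 hn2 B hB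
  obtain ⟨c1, hc1⟩ := pow_unbounded_of_one_lt (C ^ (n + 1)) (one_lt_two : (1 : ℝ) < 2)
  refine ⟨C, δ, c1, hC, hδ, ?_⟩
  rintro k hk x ⟨hxB, q, hq1, hq2, hq⟩
  have hn0 : (0 : ℝ) < n := by exact_mod_cast (by omega : 0 < n)
  have hn0' : (n : ℝ) ≠ 0 := hn0.ne'
  set H : ℝ := (2 : ℝ) ^ ((k : ℝ) / n) with hH
  set e : ℝ := (2 : ℝ) ^ (-(2 * ((k : ℝ) / n) + ε * k)) with he
  have hHn : H ^ n = 2 ^ k := by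
    rw [hH, ← Real.rpow_natCast, ← Real.rpow_mul two_pos.le, div_mul_cancel₀ _ hn0',
      Real.rpow_natCast]
  have hH1 : 1 ≤ H := Real.one_le_rpow one_le_two (by positivity)
  have he0 : 0 < e := Real.rpow_pos_of_pos two_pos _
  have heH : e * H ^ 2 = (2 : ℝ) ^ (-(ε * k)) := by
    rw [hH, he, ← Real.rpow_natCast, ← Real.rpow_mul two_pos.le, ← Real.rpow_add two_pos]
    congr 1
    push_cast
    ring
  have hq0 : 0 < q := lt_of_lt_of_le (by positivity) hq1
  have hqe : (q : ℝ) ^ (-(2 / (n : ℝ) + ε)) ≤ e := by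
    have h1 : ((2 : ℝ) ^ k) ≤ q := by exact_mod_cast hq1
    have h2 := Real.rpow_le_rpow_of_nonpos (by positivity : (0 : ℝ) < 2 ^ k) h1
      (by have : 0 < 2 / (n : ℝ) := by positivity
          linarith : -(2 / (n : ℝ) + ε) ≤ 0)
    refine h2.trans (le_of_eq ?_)
    rw [he, ← Real.rpow_natCast, ← Real.rpow_mul two_pos.le]
    congr 1
    ring
  obtain ⟨f, α, p1, g, j, D⟩ := hper H e x (fun i => round ((q : ℝ) * x ^ i)) hH1 he0
    (heH.trans_le hk) hxB (by simp; omega)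
    (by
      have h1 : (q : ℝ) < 2 ^ (k + 1) := by exact_mod_cast hq2
      rw [hHn]
      simp only [pow_zero, mul_one, round_natCast, Int.cast_natCast, Nat.abs_cast]
      rw [pow_succ] at h1
      linarith)
    (by
      intro i hi
      simp only [pow_zero, mul_one, round_natCast, Int.cast_natCast]
      rcases Nat.eq_zero_or_pos i with h0 | h0
      · subst h0
        simpa using he0.le
      · have := (hq i (Finset.mem_Icc.2 ⟨h0, hi⟩)).trans hqe
        rw [abs_sub_comm] at this
        rwa [mul_comm (x ^ i)])
  have hf0 : f ≠ 0 := D.irr.ne_zero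
  have hh1 : 1 ≤ hh f := one_le_hh hf0
  have hg1 := D.one_le_g
  have hHk : H ≤ 2 ^ k := by
    rw [← hHn]
    exact le_self_pow₀ hH1 (by omega)
  have hCn : C ≤ C ^ (n + 1) := le_self_pow₀ hC (by omega)
  have h2k : (2 : ℝ) ^ (k + c1) = 2 ^ c1 * 2 ^ k := by rw [pow_add, mul_comm]
  have hCH : C * H ≤ 2 ^ (k + c1) := by
    rw [h2k]
    exact mul_le_mul (by linarith) hHk (by linarith) (by positivity)
  have hfH : hh f ≤ C * H := le_trans (by nlinarith) D.hg
  have hgH : g ≤ C * H := le_trans (by nlinarith) D.hg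
  have heH1 : e * H ^ 2 ≤ 1 := (heH.trans_le hk).trans hδ1
  have hfe : hh f * e ≤ C := by
    have h1 : e * H ≤ 1 := by
      refine le_trans ?_ heH1
      exact mul_le_mul_of_nonneg_left (by nlinarith) he0.le
    calc hh f * e ≤ C * H * e := by gcongr
      _ = C * (e * H) := by ring
      _ ≤ C * 1 := by gcongr
      _ = C := mul_one C
  have hdj := D.dj
  have hp : |(p1 0 : ℝ)| ≤ 2 ^ (k + c1) := by
    have h1 : |(p1 0 : ℝ)| ≤ |(p1 0 : ℝ)| * g ^ (n + 1 - f.natDegree - 2 * j) :=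
      le_mul_of_one_le_right (abs_nonneg _) (one_le_pow₀ hg1)
    refine (h1.trans D.bF).trans ?_
    rw [hHn, h2k]
    have h2 : (hh f * e) ^ j ≤ C ^ n :=
      (pow_le_pow_left₀ (by positivity) hfe j).trans (pow_le_pow_right₀ hC (by omega))
    calc C * 2 ^ k * (hh f * e) ^ j ≤ C * 2 ^ k * C ^ n := by gcongr
      _ = C ^ (n + 1) * 2 ^ k := by ring
      _ ≤ 2 ^ c1 * 2 ^ k := by gcongr
  obtain ⟨a, ha, ha1, ha2⟩ := pow_near_le hh1 (hfH.trans hCH)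
  obtain ⟨b, hb, hb1, hb2⟩ := pow_near_le hg1 (hgH.trans hCH)
  obtain ⟨c, hc, hc1, hc2⟩ := pow_near_le D.one_le_U hp
  simp only [Set.mem_iUnion]
  refine ⟨((f.natDegree, j), (a, b, c)), ?_, ?_⟩
  · simp only [Finset.mem_product, Finset.mem_range]
    omega
  · exact ⟨hxB, f, α, p1, g, D, rfl, ha1, ha2, hb1, hb2, hc1, hc2⟩

lemma summable_cost (ε s K : ℝ) (hε : 0 < ε) (hs : 0 < s) (n c1 : ℕ) :
    Summable (fun k : ℕ => ((((n + 1) * (n + 1)) * ((k + c1 + 1) * ((k + c1 + 1) * (k + c1 + 1))) : ℕ) : ℝ)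
      * (K * (2 : ℝ) ^ (-(ε * s * k)))) := by
  set r : ℝ := (2 : ℝ) ^ (-(ε * s)) with hr
  have hr0 : 0 < r := Real.rpow_pos_of_pos two_pos _
  have hr1 : r < 1 := Real.rpow_lt_one_of_one_lt_of_neg one_lt_two (by
    have := mul_pos hε hs
    linarith)
  have h1 : Summable (fun k : ℕ => (k : ℝ) ^ 3 * r ^ k) :=
    summable_pow_mul_geometric_of_norm_lt_one 3 (by rwa [Real.norm_of_nonneg hr0.le])
  have h2 := (summable_nat_add_iff (c1 + 1)).2 h1
  refine (h2.mul_left (((n : ℝ) + 1) * (n + 1) * K * (r ^ (c1 + 1))⁻¹)).congr ?_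
  intro k
  have h3 : (2 : ℝ) ^ (-(ε * s * k)) = r ^ k := by
    rw [hr, ← Real.rpow_natCast, ← Real.rpow_mul two_pos.le]
    congr 1
    ring
  rw [h3, pow_add r k]
  push_cast
  field_simp
  ring

/-- The limsup set for exponent `l` inside `[-B, B]`. -/
def LS (n : ℕ) (B l : ℝ) : Set ℝ :=
  {x | |x| ≤ B ∧ {q : ℕ | 0 < q ∧
    ∀ i ∈ Finset.Icc 1 n, |(q : ℝ) * x ^ i - round ((q : ℝ) * x ^ i)| ≤ (q : ℝ) ^ (-l)}.Infinite}

lemma dimH_LS (m n : ℕ) (hn1 : 2 * m + 1 ≤ n) (hn2 : n ≤ 2 * m + 2) (B : ℝ) (hB : 1 ≤ B)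
    (s ε : ℝ) (hs1 : 1 / 2 ≤ s) (hs2 : s < 1)
    (hsn : (m : ℝ) + 2 ≤ (n + 2) * s) (hε : 0 < ε) :
    dimH (LS n B (2 / n + ε)) ≤ ENNReal.ofReal s := by
  obtain ⟨C, δ, c1, hC, hδ, hsub⟩ := TT_sub m n hn1 hn2 B hB ε hε
  obtain ⟨K, δ', hK, hδ', hcov⟩ := Cls_cover m n hn1 B hB C hC s ε hs1 hs2 hsn hε.le
  have hs0 : 0 < s := by linarith
  have hn0 : (0 : ℝ) < n := by exact_mod_cast (by omega : 0 < n)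
  have hr0 : 0 < (2 : ℝ) ^ (-ε) := Real.rpow_pos_of_pos two_pos _
  have hr1 : (2 : ℝ) ^ (-ε) < 1 :=
    Real.rpow_lt_one_of_one_lt_of_neg one_lt_two (by linarith)
  obtain ⟨k0, hk0⟩ := exists_pow_lt_of_lt_one (lt_min hδ hδ') hr1
  have hsmall : ∀ k ≥ k0, (2 : ℝ) ^ (-(ε * k)) ≤ min δ δ' := by
    intro k hk
    have h1 : (2 : ℝ) ^ (-(ε * k)) = ((2 : ℝ) ^ (-ε)) ^ k := by
      rw [← Real.rpow_natCast, ← Real.rpow_mul two_pos.le]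
      congr 1
      ring
    rw [h1]
    exact (pow_le_pow_of_le_one hr0.le hr1.le hk).trans hk0.le
  have hmu : μH[s] (LS n B (2 / n + ε)) = 0 := by
    refine covS_limsup hs0 (TT n B (2 / n + ε)) _ (summable_cost ε s K hε hs0 n c1) k0 ?_ _ ?_
    · intro k hk
      have h1 := hsmall k hk
      refine CovS.mono (covS_biUnion (c := K * (2 : ℝ) ^ (-(ε * s * k))) ((Finset.range (n + 1) ×ˢ Finset.range (n + 1)) ×ˢ
          (Finset.range (k + c1 + 1) ×ˢ Finset.range (k + c1 + 1) ×ˢ Finset.range (k + c1 + 1)))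
        (fun t => Cls m n C B ((2 : ℝ) ^ ((k : ℝ) / n)) ((2 : ℝ) ^ (-(2 * ((k : ℝ) / n) + ε * k)))
            t.1.1 t.1.2 (2 ^ t.2.1) (2 ^ t.2.2.1) (2 ^ t.2.2.2)) (fun t _ => ?_))
        (hsub k (h1.trans (min_le_left _ _))) (le_of_eq ?_)
      · refine hcov k ((k : ℝ) / n) _ _ _ _ _ (by positivity) (by positivity)
          (by field_simp) ?_
        refine le_trans (le_of_eq ?_) (h1.trans (min_le_right _ _))
        rw [← Real.rpow_natCast, ← Real.rpow_mul two_pos.le, ← Real.rpow_add two_pos]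
        congr 1
        push_cast
        ring
      · simp only [Finset.card_product, Finset.card_range]
    · rintro x ⟨hxB, hinf⟩ N
      obtain ⟨q, ⟨hq0, hq⟩, hqN⟩ := hinf.exists_gt (2 ^ N)
      refine ⟨Nat.log 2 q, Nat.le_log_of_pow_le (by norm_num) hqN.le, hxB, q,
        Nat.pow_log_le_self 2 hq0.ne', Nat.lt_pow_succ_log_self (by norm_num) q, hq⟩
  have := dimH_le_of_hausdorffMeasure_ne_top (d := s.toNNReal) (s := LS n B (2 / n + ε))
    (by rw [Real.coe_toNNReal _ hs0.le, hmu]; exact ENNReal.zero_ne_top)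
  exact this

end

end SimDioph

namespace SimDioph

lemma dimH_SimSet (m n : ℕ) (hn1 : 2 * m + 1 ≤ n) (hn2 : n ≤ 2 * m + 2) (I : Set ℝ)
    (s : ℝ) (hs1 : 1 / 2 ≤ s) (hs2 : s < 1) (hsn : (m : ℝ) + 2 ≤ (n + 2) * s) :
    dimH (SimSet n I (2 / (n : ℝ))) ≤ ENNReal.ofReal s := by
  have hsub : SimSet n I (2 / (n : ℝ)) ⊆
      ⋃ N : ℕ, ⋃ b : ℕ, LS n ((b : ℝ) + 1) (2 / n + 1 / ((N : ℝ) + 1)) := by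
    rintro x ⟨_, hx⟩
    unfold simExponent at hx
    obtain ⟨_, ⟨l, ⟨hl0, hl⟩, rfl⟩, hlt⟩ := lt_sSup_iff.1 hx
    have hlt' : 2 / (n : ℝ) < l := (ENNReal.ofReal_lt_ofReal_iff hl0).1 hlt
    obtain ⟨N, hN⟩ := exists_nat_one_div_lt (sub_pos.2 hlt')
    obtain ⟨b, hb⟩ := exists_nat_ge |x|
    refine Set.mem_iUnion.2 ⟨N, Set.mem_iUnion.2 ⟨b, by linarith, ?_⟩⟩
    refine hl.mono ?_
    rintro q ⟨hq0, hq⟩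
    refine ⟨hq0, fun i hi => (hq i hi).trans ?_⟩
    exact Real.rpow_le_rpow_of_exponent_le (by exact_mod_cast hq0) (by linarith)
  refine (dimH_mono hsub).trans ?_
  simp only [dimH_iUnion]
  refine iSup_le fun N => iSup_le fun b => ?_
  refine dimH_LS m n hn1 hn2 _ ?_ s _ hs1 hs2 hsn (by positivity)
  have : (0 : ℝ) ≤ b := Nat.cast_nonneg b
  linarith

end SimDioph

/-- If `n = 2m+1` then `dim S_n(I, 2/n) ≤ (m+2)/(2m+3)`; if `n = 2m+2` then
`dim S_n(I, 2/n) ≤ (m+3)/(2m+4)`, for every interval `I ⊆ ℝ`. -/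
theorem stmt1 (m n : ℕ) (I : Set ℝ) (hI : I.OrdConnected) :
    (n = 2 * m + 1 →
      dimH (SimSet n I (2 / (n : ℝ))) ≤
        ENNReal.ofReal (((m : ℝ) + 2) / (2 * (m : ℝ) + 3))) ∧
    (n = 2 * m + 2 →
      dimH (SimSet n I (2 / (n : ℝ))) ≤
        ENNReal.ofReal (((m : ℝ) + 3) / (2 * (m : ℝ) + 4))) := by
  constructor
  · intro hn
    refine SimDioph.dimH_SimSet m n (by omega) (by omega) I _ ?_ ?_ ?_
    · rw [div_le_div_iff₀ (by norm_num) (by positivity)]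
      linarith
    · rw [div_lt_one (by positivity)]
      have : (0 : ℝ) ≤ m := Nat.cast_nonneg m
      linarith
    · rw [hn]
      push_cast
      apply le_of_eq
      field_simp
      ring
  · intro hn
    refine SimDioph.dimH_SimSet m n (by omega) (by omega) I _ ?_ ?_ ?_
    · rw [div_le_div_iff₀ (by norm_num) (by positivity)]
      linarith
    · rw [div_lt_one (by positivity)]
      have : (0 : ℝ) ≤ m := Nat.cast_nonneg m
      linarith
    · rw [hn]
      push_cast
      have : (2 * (m : ℝ) + 2 + 2) * (((m : ℝ) + 3) / (2 * m + 4)) = m + 3 := by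
        field_simp
        ring
      rw [this]
      linarith
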